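/- Let s > 1/2, let B ∈ ℝ^{d×d} be a symmetric matrix, set g(x) = e^{i⟨Bx,x⟩/2}, and let u ∈ 𝒮'(ℝ^d) be a tempered distribution. Let g·u ∈ 𝒮'(ℝ^d) be the tempered distribution defined by (g·u)(φ) = u(g·φ) (note g·φ is Schwartz for φ Schwartz since g is smooth with all derivatives polynomially bounded). Then WF^s(g·u) = { (x, Bx + ξ) : (x,ξ) ∈ WF^s(u) }. -/

import Mathlib

open MeasureTheory Filter
open scoped BigOperators ENNReal RealInnerProductSpace

noncomputable section

/-- `ℝ^d` with the Euclidean norm. -/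
abbrev Ed (d : ℕ) : Type := EuclideanSpace ℝ (Fin d)

/-- Partial derivative along the `i`-th coordinate direction. -/
def pdGS {d : ℕ} (i : Fin d) (f : Ed d → ℂ) : Ed d → ℂ :=
  fun x => fderiv ℝ f x (EuclideanSpace.single i 1)

/-- Multi-index partial derivative `∂^β`. -/
def mderiv {d : ℕ} (β : Fin d → ℕ) (f : Ed d → ℂ) : Ed d → ℂ :=
  ((List.ofFn fun i : Fin d => (pdGS i)^[β i]).foldr (· ∘ ·) id) f

/-- Monomial `x^α`. -/
def mpow {d : ℕ} (x : Ed d) (α : Fin d → ℕ) : ℝ := ∏ i, x i ^ α i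

/-- Multi-index factorial `α!`. -/
def mfact {d : ℕ} (α : Fin d → ℕ) : ℕ := ∏ i, Nat.factorial (α i)

/-- Multi-index length `|α|`. -/
def mlen {d : ℕ} (α : Fin d → ℕ) : ℕ := ∑ i, α i

/-- The Gelfand–Shilov seminorm `‖f‖_{S_{s,h}}`, valued in `[0,∞]`. -/
def GSnorm {d : ℕ} (s h : ℝ) (f : Ed d → ℂ) : ℝ≥0∞ :=
  ⨆ (x : Ed d) (α : Fin d → ℕ) (β : Fin d → ℕ),
    ENNReal.ofReal (|mpow x α| * ‖mderiv β f x‖ /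
      (h ^ (mlen α + mlen β) * ((mfact α : ℝ) * (mfact β : ℝ)) ^ s))

/-- The Gelfand–Shilov space `Σ_s(ℝ^d)`: smooth functions all of whose
`S_{s,h}` seminorms are finite. -/
def SigmaGS (s : ℝ) (d : ℕ) : Set (Ed d → ℂ) :=
  {f | ContDiff ℝ ((⊤ : ℕ∞) : WithTop ℕ∞) f ∧ ∀ h : ℝ, 0 < h → GSnorm s h f < ⊤}

/-- The seminorm `|f|_A`, valued in `[0,∞]`. -/
def GSnormA {d : ℕ} (s A : ℝ) (f : Ed d → ℂ) : ℝ≥0∞ :=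
  ⨆ (x : Ed d) (β : Fin d → ℕ),
    ENNReal.ofReal (A ^ mlen β * Real.exp (A * ‖x‖ ^ (1/s)) * ‖mderiv β f x‖ /
      (mfact β : ℝ) ^ s)

/-- The Fourier transform `f̂(ξ) = ∫ f(x) e^{-i⟨x,ξ⟩} dx`. -/
def FTgs {d : ℕ} (f : Ed d → ℂ) (ξ : Ed d) : ℂ :=
  ∫ x : Ed d, f x * Complex.exp (-(Complex.I * (⟪x, ξ⟫ : ℝ)))

/-- The short-time Fourier transform of a function `f` with window `φ`. -/
def STFTgs {d : ℕ} (φ f : Ed d → ℂ) (z : Ed d × Ed d) : ℂ :=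
  ∫ y : Ed d, f y * (starRingEnd ℂ) (φ (y - z.1)) * Complex.exp (-(Complex.I * (⟪y, z.2⟫ : ℝ)))

/-- Euclidean norm of a phase-space point `(x,ξ) ∈ ℝ^{2d}`. -/
def pnorm {d : ℕ} (z : Ed d × Ed d) : ℝ := Real.sqrt (‖z.1‖ ^ 2 + ‖z.2‖ ^ 2)

/-- A conic subset: invariant under multiplication by positive reals. -/
def IsConic {V : Type*} [SMul ℝ V] (Γ : Set V) : Prop :=
  ∀ t : ℝ, 0 < t → ∀ z ∈ Γ, t • z ∈ Γ

/-- Tempered distributions on `ℝ^d`. -/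
abbrev TD (d : ℕ) : Type := SchwartzMap (Ed d) ℂ →L[ℂ] ℂ

/-- `W` is the short-time Fourier transform `V_φ u` of the tempered distribution `u`
with respect to the window `φ`. -/
def IsSTFT {d : ℕ} (u : TD d) (φ : Ed d → ℂ) (W : Ed d × Ed d → ℂ) : Prop :=
  ∀ (x ξ : Ed d) (g : SchwartzMap (Ed d) ℂ),
    (∀ y : Ed d, g y = (starRingEnd ℂ) (φ (y - x)) * Complex.exp (-(Complex.I * (⟪y, ξ⟫ : ℝ)))) →
    W (x, ξ) = u g

/-- The `s`-Gelfand–Shilov wave front set of a distribution whose short-time Fourier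
transform is `W`: the set of nonzero phase-space points having no open conic
neighbourhood on which `e^{A|z|^{1/s}} |W(z)|` is bounded for every `A > 0`. -/
def WFs {d : ℕ} (s : ℝ) (W : Ed d × Ed d → ℂ) : Set (Ed d × Ed d) :=
  {z₀ | z₀ ≠ 0 ∧ ¬ ∃ Γ : Set (Ed d × Ed d), IsOpen Γ ∧ IsConic Γ ∧
    (0 : Ed d × Ed d) ∉ Γ ∧ z₀ ∈ Γ ∧
    ∀ A : ℝ, 0 < A → ∃ C : ℝ, ∀ z ∈ Γ, Real.exp (A * pnorm z ^ (1/s)) * ‖W z‖ ≤ C}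

/-- The real quadratic form `⟨Bx, x⟩` of a matrix `B`. -/
def qf {d : ℕ} (B : Matrix (Fin d) (Fin d) ℝ) (x : Ed d) : ℝ :=
  ∑ i, (∑ j, B i j * x j) * x i

/-- Tempered distributions on `ℝ^m × ℝ^n`. -/
abbrev TD2 (m n : ℕ) : Type := SchwartzMap (Ed m × Ed n) ℂ →L[ℂ] ℂ

/-- Short-time Fourier transform of a tempered distribution on `ℝ^m × ℝ^n`. -/
def IsSTFT2 {m n : ℕ} (w : TD2 m n) (Φ : Ed m × Ed n → ℂ)
    (W : (Ed m × Ed n) × (Ed m × Ed n) → ℂ) : Prop :=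
  ∀ (x ξ : Ed m × Ed n) (g : SchwartzMap (Ed m × Ed n) ℂ),
    (∀ y : Ed m × Ed n, g y = (starRingEnd ℂ) (Φ (y - x)) *
      Complex.exp (-(Complex.I * ((⟪y.1, ξ.1⟫ + ⟪y.2, ξ.2⟫ : ℝ))))) →
    W (x, ξ) = w g

/-- Euclidean norm of a phase-space point of `T^*(ℝ^m × ℝ^n)`. -/
def pnorm2 {m n : ℕ} (z : (Ed m × Ed n) × (Ed m × Ed n)) : ℝ :=
  Real.sqrt (‖z.1.1‖ ^ 2 + ‖z.1.2‖ ^ 2 + ‖z.2.1‖ ^ 2 + ‖z.2.2‖ ^ 2)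

/-- The `s`-Gelfand–Shilov wave front set on `ℝ^m × ℝ^n`. -/
def WFs2 {m n : ℕ} (s : ℝ) (W : (Ed m × Ed n) × (Ed m × Ed n) → ℂ) :
    Set ((Ed m × Ed n) × (Ed m × Ed n)) :=
  {z₀ | z₀ ≠ 0 ∧ ¬ ∃ Γ : Set ((Ed m × Ed n) × (Ed m × Ed n)), IsOpen Γ ∧ IsConic Γ ∧
    (0 : (Ed m × Ed n) × (Ed m × Ed n)) ∉ Γ ∧ z₀ ∈ Γ ∧
    ∀ A : ℝ, 0 < A → ∃ C : ℝ, ∀ z ∈ Γ, Real.exp (A * pnorm2 z ^ (1/s)) * ‖W z‖ ≤ C}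

section WeakIntegral

open SchwartzMap LineDeriv Topology

theorem map_eq_integral_of_norming {V Z T : Type*} [AddCommGroup V] [Module ℂ V]
    [TopologicalSpace V] [TopologicalSpace Z] [MeasurableSpace Z] [BorelSpace Z]
    [SecondCountableTopology Z] {μ : Measure Z}
    (Λ : T → V →ₗ[ℂ] ℂ) (p : Seminorm ℂ V) (hp : Continuous p)
    (hΛ : ∀ t f, ‖Λ t f‖ ≤ p f) (hnorm : ∀ f M, 0 ≤ M → (∀ t, ‖Λ t f‖ ≤ M) → p f ≤ M)
    [IsTopologicalAddGroup V]
    (u : V →ₗ[ℂ] ℂ) (C : ℝ) (hu : ∀ f, ‖u f‖ ≤ C * p f)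
    (F : Z → V) (hF : Continuous F) (hint : Integrable (fun z => p (F z)) μ)
    (G : V) (hG : ∀ t, Λ t G = ∫ z, Λ t (F z) ∂μ) :
    u G = ∫ z, u (F z) ∂μ := by
  let J : V →ₗ[ℂ] lp (fun _ : T => ℂ) ∞ :=
    { toFun := fun f => ⟨fun t => Λ t f, memℓp_infty ⟨p f, by rintro _ ⟨t, rfl⟩; exact hΛ t f⟩⟩
      map_add' := fun f g => by ext t; exact map_add (Λ t) f g
      map_smul' := fun c f => by ext t; exact map_smul (Λ t) c f }
  have hJ : ∀ f t, (J f : T → ℂ) t = Λ t f := fun _ _ => rfl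
  have hJle : ∀ f, ‖J f‖ ≤ p f := fun f =>
    lp.norm_le_of_forall_le (apply_nonneg p f) fun t => hΛ t f
  have hJge : ∀ f, p f ≤ ‖J f‖ := fun f =>
    hnorm f _ (norm_nonneg _) fun t => lp.norm_apply_le_norm (by simp) (J f) t
  have hC : ∀ f, ‖u f‖ ≤ |C| * ‖J f‖ := fun f =>
    (hu f).trans <| (mul_le_mul_of_nonneg_right (le_abs_self C) (apply_nonneg p f)).trans <|
      mul_le_mul_of_nonneg_left (hJge f) (abs_nonneg C)
  have hker : LinearMap.ker J ≤ LinearMap.ker u := fun f hf => by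
    have h1 : J f = 0 := hf
    have := hC f
    rw [h1, norm_zero, mul_zero] at this
    exact norm_le_zero_iff.1 this
  let u₀ : LinearMap.range J →ₗ[ℂ] ℂ :=
    ((LinearMap.ker J).liftQ u hker).comp J.quotKerEquivRange.symm.toLinearMap
  have hu₀ : ∀ f, u₀ ⟨J f, LinearMap.mem_range_self J f⟩ = u f := fun f => by
    have : J.quotKerEquivRange.symm ⟨J f, LinearMap.mem_range_self J f⟩
        = (LinearMap.ker J).mkQ f := by
      rw [LinearEquiv.symm_apply_eq]; rfl
    simp only [u₀, LinearMap.comp_apply, LinearEquiv.coe_coe, this]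
    rfl
  have hb : ∀ x : LinearMap.range J, ‖u₀ x‖ ≤ |C| * ‖x‖ := by
    rintro ⟨_, f, rfl⟩
    rw [hu₀ f]
    exact hC f
  obtain ⟨U, hU, -⟩ := exists_extension_norm_eq (LinearMap.range J) (u₀.mkContinuous |C| hb)
  have hUJ : ∀ f, U (J f) = u f := fun f => by
    have := hU ⟨J f, LinearMap.mem_range_self J f⟩
    rw [LinearMap.mkContinuous_apply, hu₀] at this
    exact this
  have hJc : Continuous (fun z => J (F z)) := by
    rw [continuous_iff_continuousAt]
    intro z₀
    rw [ContinuousAt, tendsto_iff_norm_sub_tendsto_zero]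
    have h2 : Tendsto (fun z => p (F z - F z₀)) (𝓝 z₀) (𝓝 0) := by
      have : Continuous fun z => p (F z - F z₀) := hp.comp (hF.sub continuous_const)
      simpa using this.tendsto z₀
    refine squeeze_zero (fun _ => norm_nonneg _) (fun z => ?_) h2
    rw [← map_sub]
    exact hJle _
  have hJint : Integrable (fun z => J (F z)) μ :=
    hint.mono' hJc.aestronglyMeasurable (Eventually.of_forall fun z => hJle _)
  have key : ∫ z, J (F z) ∂μ = J G := by
    ext t
    have := (lp.evalCLM ℂ (fun _ : T => ℂ) ∞ t).integral_comp_comm hJint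
    rw [hJ, hG t]
    exact this.symm
  rw [← hUJ G, ← key, ← U.integral_comp_comm hJint]
  simp_rw [hUJ]

variable {E : Type*} [NormedAddCommGroup E] [NormedSpace ℝ E]

theorem continuous_schwartzMap_seminorm (k l : ℕ) :
    Continuous (SchwartzMap.seminorm ℂ k l : Seminorm ℂ 𝓢(E, ℂ)) :=
  (schwartz_withSeminorms ℂ E ℂ).continuous_seminorm (k, l)

theorem continuous_eval_schwartzMap (y : E) : Continuous fun f : 𝓢(E, ℂ) => f y := by
  have h := (SchwartzMap.toBoundedContinuousFunctionCLM ℂ E ℂ).continuous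
  exact (continuous_eval_const (F := BoundedContinuousFunction E ℂ) y).comp h

theorem seminorm_lineDerivOp_le (k l : ℕ) (m : E) (f : 𝓢(E, ℂ)) :
    SchwartzMap.seminorm ℂ k l (∂_{m} f) ≤ ‖m‖ * SchwartzMap.seminorm ℂ k (l + 1) f := by
  refine SchwartzMap.seminorm_le_bound ℂ k l _ (by positivity) fun x => ?_
  have h1 : ‖iteratedFDeriv ℝ l (∂_{m} f : 𝓢(E, ℂ)) x‖ ≤ ‖m‖ * ‖iteratedFDeriv ℝ (l + 1) f x‖ := by
    refine ContinuousMultilinearMap.opNorm_le_bound (by positivity) fun v => ?_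
    rw [← SchwartzMap.iteratedLineDerivOp_eq_iteratedFDeriv]
    have h2 : ∂^{v} (∂_{m} f) = ∂^{(Fin.snoc v m : Fin (l + 1) → E)} f := by
      rw [iteratedLineDerivOp_succ_right]
      simp
    rw [h2, SchwartzMap.iteratedLineDerivOp_eq_iteratedFDeriv]
    refine (ContinuousMultilinearMap.le_opNorm _ _).trans (le_of_eq ?_)
    rw [Fin.prod_univ_castSucc]
    simp
    ring
  calc ‖x‖ ^ k * ‖iteratedFDeriv ℝ l (∂_{m} f : 𝓢(E, ℂ)) x‖
      ≤ ‖x‖ ^ k * (‖m‖ * ‖iteratedFDeriv ℝ (l + 1) f x‖) := by gcongr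
    _ = ‖m‖ * (‖x‖ ^ k * ‖iteratedFDeriv ℝ (l + 1) f x‖) := by ring
    _ ≤ _ := by gcongr; exact SchwartzMap.le_seminorm ℂ k (l + 1) f x

variable {Z : Type*} [TopologicalSpace Z] [MeasurableSpace Z] [BorelSpace Z]
    [SecondCountableTopology Z] {μ : Measure Z}

theorem lineDerivOp_eq_integral (F : Z → 𝓢(E, ℂ)) (hF : Continuous F)
    (hint : ∀ k l, Integrable (fun z => SchwartzMap.seminorm ℂ k l (F z)) μ)
    (G : 𝓢(E, ℂ)) (hG : ∀ y, G y = ∫ z, F z y ∂μ) (m y : E) :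
    (∂_{m} G) y = ∫ z, (∂_{m} (F z)) y ∂μ := by
  have hcd : Continuous fun f : 𝓢(E, ℂ) => fderiv ℝ f y := by
    have h := (SchwartzMap.toBoundedContinuousFunctionCLM ℝ E (E →L[ℝ] ℂ)).continuous.comp
      (SchwartzMap.fderivCLM ℝ E ℂ).continuous
    exact (continuous_eval_const (F := BoundedContinuousFunction E (E →L[ℝ] ℂ)) y).comp h
  have hfd : ∀ (f : 𝓢(E, ℂ)) (x : E), ‖fderiv ℝ f x‖ ≤ SchwartzMap.seminorm ℂ 0 1 f := by
    intro f x
    rw [← norm_iteratedFDeriv_one]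
    exact SchwartzMap.norm_iteratedFDeriv_le_seminorm ℂ f 1 x
  have hFm : ∀ x, AEStronglyMeasurable (fun z => F z x) μ := fun x =>
    ((continuous_eval_schwartzMap x).comp hF).aestronglyMeasurable
  have hdm : AEStronglyMeasurable (fun z => fderiv ℝ (F z) y) μ :=
    (hcd.comp hF).aestronglyMeasurable
  have hd : HasFDerivAt (fun x => ∫ z, F z x ∂μ) (∫ z, fderiv ℝ (F z) y ∂μ) y := by
    refine hasFDerivAt_integral_of_dominated_of_fderiv_le (𝕜 := ℝ)
      (F' := fun x z => fderiv ℝ (F z) x)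
      (bound := fun z => SchwartzMap.seminorm ℂ 0 1 (F z)) (s := Set.univ) univ_mem
      (Eventually.of_forall hFm) ?_ hdm (Eventually.of_forall fun z x _ => hfd _ _) (hint 0 1)
      (Eventually.of_forall fun z x _ => (F z).hasFDerivAt x)
    exact (hint 0 0).mono' (hFm y) (Eventually.of_forall fun z =>
      SchwartzMap.norm_le_seminorm ℂ _ _)
  have hdi : Integrable (fun z => fderiv ℝ (F z) y) μ :=
    (hint 0 1).mono' hdm (Eventually.of_forall fun z => hfd _ _)
  have hGf : (G : E → ℂ) = fun x => ∫ z, F z x ∂μ := funext hG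
  rw [SchwartzMap.lineDerivOp_apply_eq_fderiv, hGf, hd.fderiv,
    ContinuousLinearMap.integral_apply hdi]
  rfl

theorem iteratedLineDerivOp_eq_integral (n : ℕ) (m : Fin n → E) (F : Z → 𝓢(E, ℂ))
    (hF : Continuous F)
    (hint : ∀ k l, Integrable (fun z => SchwartzMap.seminorm ℂ k l (F z)) μ)
    (G : 𝓢(E, ℂ)) (hG : ∀ y, G y = ∫ z, F z y ∂μ) (y : E) :
    (∂^{m} G) y = ∫ z, (∂^{m} (F z)) y ∂μ := by
  induction n generalizing F G with
  | zero => simpa using hG y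
  | succ n ih =>
    simp_rw [iteratedLineDerivOp_succ_right]
    have hc : Continuous fun z => ∂_{m (Fin.last n)} (F z) :=
      (lineDerivOpCLM ℂ 𝓢(E, ℂ) (m (Fin.last n))).continuous.comp hF
    refine ih _ _ hc (fun k l => ?_) _ (lineDerivOp_eq_integral F hF hint G hG _)
    refine ((hint k (l + 1)).const_mul ‖m (Fin.last n)‖).mono'
      ((continuous_schwartzMap_seminorm k l).comp hc).aestronglyMeasurable
      (Eventually.of_forall fun z => ?_)
    rw [Real.norm_of_nonneg (apply_nonneg _ _)]
    exact seminorm_lineDerivOp_le _ _ _ _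

theorem exists_norm_le_finset_sup_seminorm (u : 𝓢(E, ℂ) →L[ℂ] ℂ) :
    ∃ (s : Finset (ℕ × ℕ)) (C : ℝ), 0 ≤ C ∧
      ∀ f, ‖u f‖ ≤ C * s.sup (schwartzSeminormFamily ℂ E ℂ) f := by
  obtain ⟨s, C, -, h⟩ := Seminorm.bound_of_continuous (schwartz_withSeminorms ℂ E ℂ)
    ((normSeminorm ℂ ℂ).comp u.toLinearMap) (continuous_norm.comp u.continuous)
  exact ⟨s, C, C.2, fun f => h f⟩

/-- A tempered distribution commutes with weak integrals of Schwartz functions. -/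
theorem map_eq_integral_schwartzMap (u : 𝓢(E, ℂ) →L[ℂ] ℂ) (F : Z → 𝓢(E, ℂ)) (hF : Continuous F)
    (hint : ∀ k l, Integrable (fun z => SchwartzMap.seminorm ℂ k l (F z)) μ)
    (G : 𝓢(E, ℂ)) (hG : ∀ y, G y = ∫ z, F z y ∂μ) :
    u G = ∫ z, u (F z) ∂μ := by
  obtain ⟨s, C, -, hu⟩ := exists_norm_le_finset_sup_seminorm u
  let T := {t : (Σ kl : ℕ × ℕ, E × (Fin kl.2 → E)) // t.1 ∈ s}
  let a : T → ℝ := fun t => ‖t.1.2.1‖ ^ t.1.1.1 * (∏ i, ‖t.1.2.2 i‖)⁻¹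
  let Λ : T → 𝓢(E, ℂ) →ₗ[ℂ] ℂ := fun t =>
    { toFun := fun f => (a t : ℂ) * (∂^{t.1.2.2} f) t.1.2.1
      map_add' := fun f g => by simp [iteratedLineDerivOp_add, mul_add]
      map_smul' := fun c f => by
        simp [iteratedLineDerivOp_smul]; ring }
  have hΛ : ∀ t f, Λ t f = (a t : ℂ) * (∂^{t.1.2.2} f) t.1.2.1 := fun _ _ => rfl
  have ha : ∀ t, 0 ≤ a t := fun t => by positivity
  let p : Seminorm ℂ 𝓢(E, ℂ) := s.sup (schwartzSeminormFamily ℂ E ℂ)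
  have hsum : Continuous fun f : 𝓢(E, ℂ) => ∑ i ∈ s, schwartzSeminormFamily ℂ E ℂ i f :=
    continuous_finsetSum s fun i _ => continuous_schwartzMap_seminorm i.1 i.2
  have hple' : ∀ f, p f ≤ ∑ i ∈ s, schwartzSeminormFamily ℂ E ℂ i f := fun f =>
    Seminorm.finset_sup_apply_le (Finset.sum_nonneg fun i _ => apply_nonneg _ f) fun i hi =>
      Finset.single_le_sum (f := fun i => schwartzSeminormFamily ℂ E ℂ i f)
        (fun i _ => apply_nonneg _ f) hi
  have hpc : Continuous p := by
    refine Seminorm.continuous_of_continuousAt_zero ?_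
    rw [ContinuousAt, map_zero]
    refine squeeze_zero (fun f => apply_nonneg p f) hple' ?_
    simpa using hsum.tendsto 0
  refine map_eq_integral_of_norming Λ p hpc ?_ ?_
    u.toLinearMap C hu F hF ?_ G ?_
  · rintro ⟨⟨⟨k, l⟩, y, m⟩, ht⟩ f
    have h1 : SchwartzMap.seminorm ℂ k l f ≤ s.sup (schwartzSeminormFamily ℂ E ℂ) f :=
      Finset.le_sup (f := schwartzSeminormFamily ℂ E ℂ) ht f
    refine le_trans ?_ h1
    rw [hΛ, norm_mul, Complex.norm_real, Real.norm_of_nonneg (ha _),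
      SchwartzMap.iteratedLineDerivOp_eq_iteratedFDeriv]
    refine le_trans ?_ (SchwartzMap.le_seminorm ℂ k l f y)
    simp only [a]
    rw [mul_assoc]
    gcongr
    rw [inv_mul_eq_div]
    exact div_le_of_le_mul₀ (by positivity) (by positivity)
      (ContinuousMultilinearMap.le_opNorm _ _)
  · intro f M hM h
    refine Seminorm.finset_sup_apply_le hM fun kl hkl => ?_
    refine SchwartzMap.seminorm_le_bound ℂ kl.1 kl.2 f hM fun y => ?_
    have hop : ‖(‖y‖ ^ kl.1) • iteratedFDeriv ℝ kl.2 f y‖ ≤ M := by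
      refine ContinuousMultilinearMap.opNorm_le_bound hM fun m => ?_
      by_cases hm : ∃ i, m i = 0
      · obtain ⟨i, hi⟩ := hm
        rw [ContinuousMultilinearMap.map_coord_zero _ i hi, norm_zero]
        positivity
      · push Not at hm
        have hpos : 0 < ∏ i, ‖m i‖ := Finset.prod_pos fun i _ => norm_pos_iff.2 (hm i)
        have := h ⟨⟨kl, y, m⟩, hkl⟩
        rw [hΛ, norm_mul, Complex.norm_real, Real.norm_of_nonneg (ha _),
          SchwartzMap.iteratedLineDerivOp_eq_iteratedFDeriv] at this
        simp only [a] at this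
        rw [mul_right_comm, ← div_eq_mul_inv, div_le_iff₀ hpos] at this
        simpa [norm_smul] using this
    simpa [norm_smul] using hop
  · refine (integrable_finsetSum s fun i _ => hint i.1 i.2).mono'
      (hpc.comp hF).aestronglyMeasurable (Eventually.of_forall fun z => ?_)
    rw [Real.norm_of_nonneg (apply_nonneg _ _)]
    exact hple' _
  · intro t
    rw [hΛ, iteratedLineDerivOp_eq_integral _ _ F hF hint G hG, ← integral_const_mul]
    rfl

end WeakIntegral

section PhaseSpaceShifts

open SchwartzMap LineDeriv Topology FourierTransform

section Translation

variable {E : Type*} [NormedAddCommGroup E] [NormedSpace ℝ E]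

/-- The seminorm `f ↦ sup_{k' ≤ k, l' ≤ l} sup_x ‖x‖^k' ‖D^l' f(x)‖` on Schwartz space. -/
def schwartzSup (k l : ℕ) : Seminorm ℂ 𝓢(E, ℂ) :=
  (Finset.Iic (k, l)).sup fun m => SchwartzMap.seminorm ℂ m.1 m.2

theorem continuous_schwartzSup (k l : ℕ) : Continuous (schwartzSup k l : Seminorm ℂ 𝓢(E, ℂ)) := by
  refine Seminorm.continuous_of_continuousAt_zero ?_
  rw [ContinuousAt, map_zero]
  have hsum : Continuous fun f : 𝓢(E, ℂ) =>
      ∑ i ∈ Finset.Iic (k, l), SchwartzMap.seminorm ℂ i.1 i.2 f :=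
    continuous_finsetSum _ fun i _ => continuous_schwartzMap_seminorm i.1 i.2
  refine squeeze_zero (fun f => apply_nonneg _ f) (fun f => ?_) (by simpa using hsum.tendsto 0)
  exact Seminorm.finset_sup_apply_le (Finset.sum_nonneg fun i _ => apply_nonneg _ f) fun i hi =>
      Finset.single_le_sum (f := fun i : ℕ × ℕ => SchwartzMap.seminorm ℂ i.1 i.2 f)
        (fun i _ => apply_nonneg _ f) hi

theorem seminorm_compSubConst_le (k l : ℕ) (x : E) (f : 𝓢(E, ℂ)) :
    SchwartzMap.seminorm ℂ k l (compSubConstCLM ℂ x f) ≤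
      (1 + ‖x‖) ^ k * (2 ^ k * schwartzSup k l f) := by
  refine SchwartzMap.seminorm_le_bound ℂ k l _
    (mul_nonneg (by positivity) (mul_nonneg (by positivity) (apply_nonneg _ _))) fun y => ?_
  have h1 : iteratedFDeriv ℝ l (compSubConstCLM ℂ x f) y = iteratedFDeriv ℝ l f (y - x) := by
    have : (compSubConstCLM ℂ x f : E → ℂ) = fun y => f (y - x) := by
      ext y; exact compSubConstCLM_apply f x y
    rw [this, iteratedFDeriv_comp_sub]
  rw [h1]
  have h2 : ‖y‖ ≤ (1 + ‖x‖) * (1 + ‖y - x‖) := by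
    have := norm_add_le (y - x) x
    rw [sub_add_cancel] at this
    nlinarith [norm_nonneg x, norm_nonneg (y - x), mul_nonneg (norm_nonneg x) (norm_nonneg (y - x))]
  calc ‖y‖ ^ k * ‖iteratedFDeriv ℝ l f (y - x)‖
      ≤ ((1 + ‖x‖) * (1 + ‖y - x‖)) ^ k * ‖iteratedFDeriv ℝ l f (y - x)‖ := by gcongr
    _ = (1 + ‖x‖) ^ k * ((1 + ‖y - x‖) ^ k * ‖iteratedFDeriv ℝ l f (y - x)‖) := by
        rw [mul_pow]; ring
    _ ≤ _ := by
        refine mul_le_mul_of_nonneg_left ?_ (by positivity)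
        exact one_add_le_sup_seminorm_apply (𝕜 := ℂ) (m := (k, l)) le_rfl le_rfl f (y - x)

theorem seminorm_compSubConst_sub_le (k l : ℕ) (x x₀ : E) (f : 𝓢(E, ℂ)) :
    SchwartzMap.seminorm ℂ k l (compSubConstCLM ℂ x f - compSubConstCLM ℂ x₀ f) ≤
      ‖x - x₀‖ * ((1 + (‖x‖ + ‖x₀‖)) ^ k * (2 ^ k * schwartzSup k (l + 1) f)) := by
  refine SchwartzMap.seminorm_le_bound ℂ k l _
    (mul_nonneg (by positivity) (mul_nonneg (by positivity)
      (mul_nonneg (by positivity) (apply_nonneg _ _)))) fun y => ?_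
  have hcd : ∀ x : E, (compSubConstCLM ℂ x f : E → ℂ) = fun y => f (y - x) := fun x => by
    ext y; exact compSubConstCLM_apply f x y
  have h1 : iteratedFDeriv ℝ l (compSubConstCLM ℂ x f - compSubConstCLM ℂ x₀ f : 𝓢(E, ℂ)) y =
      iteratedFDeriv ℝ l f (y - x) - iteratedFDeriv ℝ l f (y - x₀) := by
    have : ((compSubConstCLM ℂ x f - compSubConstCLM ℂ x₀ f : 𝓢(E, ℂ)) : E → ℂ)
        = (compSubConstCLM ℂ x f : E → ℂ) - (compSubConstCLM ℂ x₀ f : E → ℂ) := by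
      ext y; simp
    rw [this, iteratedFDeriv_sub_apply ((SchwartzMap.smooth _ l).contDiffAt)
      ((SchwartzMap.smooth _ l).contDiffAt), hcd, hcd, iteratedFDeriv_comp_sub,
      iteratedFDeriv_comp_sub]
  rw [h1]
  let K := (1 + (‖x‖ + ‖x₀‖)) ^ k * (2 ^ k * schwartzSup k (l + 1) f)
  have hdf : Differentiable ℝ (iteratedFDeriv ℝ l f) :=
    (f.smooth ⊤).differentiable_iteratedFDeriv (mod_cast ENat.natCast_lt_top l)
  rcases (pow_nonneg (norm_nonneg y) k).eq_or_lt with h0 | hpos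
  · rw [← h0, zero_mul]
    exact mul_nonneg (by positivity) (mul_nonneg (by positivity)
      (mul_nonneg (by positivity) (apply_nonneg _ _)))
  have hder : ∀ w : E, HasFDerivAt (fun w => iteratedFDeriv ℝ l f (y - w))
      ((fderiv ℝ (iteratedFDeriv ℝ l f) (y - w)).comp (-ContinuousLinearMap.id ℝ E)) w := by
    intro w
    have h2 : HasFDerivAt (fun w : E => y - w) (-ContinuousLinearMap.id ℝ E) w :=
      (hasFDerivAt_id w).const_sub y
    exact (hdf (y - w)).hasFDerivAt.comp w h2
  have hbd : ∀ w ∈ Metric.closedBall (0 : E) (‖x‖ + ‖x₀‖),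
      ‖(fderiv ℝ (iteratedFDeriv ℝ l f) (y - w)).comp (-ContinuousLinearMap.id ℝ E)‖
        ≤ K / ‖y‖ ^ k := by
    intro w hw
    rw [mem_closedBall_zero_iff] at hw
    have h2 : ‖y‖ ≤ (1 + (‖x‖ + ‖x₀‖)) * (1 + ‖y - w‖) := by
      have := norm_add_le (y - w) w
      rw [sub_add_cancel] at this
      nlinarith [norm_nonneg w, norm_nonneg (y - w),
        mul_nonneg (norm_nonneg w) (norm_nonneg (y - w)),
        mul_le_mul_of_nonneg_right hw (norm_nonneg (y - w))]
    have h3 : ‖(fderiv ℝ (iteratedFDeriv ℝ l f) (y - w)).comp (-ContinuousLinearMap.id ℝ E)‖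
        ≤ ‖iteratedFDeriv ℝ (l + 1) f (y - w)‖ := by
      refine ContinuousLinearMap.opNorm_le_bound _ (norm_nonneg _) fun v => ?_
      rw [← norm_fderiv_iteratedFDeriv]
      refine (ContinuousLinearMap.le_opNorm _ _).trans (le_of_eq ?_)
      simp
    refine h3.trans ?_
    rw [le_div_iff₀ hpos, mul_comm]
    calc _ ≤ ((1 + (‖x‖ + ‖x₀‖)) * (1 + ‖y - w‖)) ^ k * ‖iteratedFDeriv ℝ (l + 1) f (y - w)‖ := by
          gcongr
      _ = (1 + (‖x‖ + ‖x₀‖)) ^ k *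
          ((1 + ‖y - w‖) ^ k * ‖iteratedFDeriv ℝ (l + 1) f (y - w)‖) := by rw [mul_pow]; ring
      _ ≤ K := by
          dsimp only [K]
          refine mul_le_mul_of_nonneg_left ?_ (by positivity)
          exact one_add_le_sup_seminorm_apply (𝕜 := ℂ) (m := (k, l + 1)) le_rfl le_rfl f (y - w)
  have := (convex_closedBall (0 : E) (‖x‖ + ‖x₀‖)).norm_image_sub_le_of_norm_hasFDerivWithin_le
    (fun w _ => (hder w).hasFDerivWithinAt) hbd
    (show x₀ ∈ _ by simp) (show x ∈ _ by simp)
  calc _ ≤ ‖y‖ ^ k * (K / ‖y‖ ^ k * ‖x - x₀‖) := by gcongr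
    _ = ‖x - x₀‖ * K := by field_simp

theorem continuous_compSubConst :
    Continuous fun p : E × 𝓢(E, ℂ) => compSubConstCLM ℂ p.1 p.2 := by
  rw [continuous_iff_continuousAt]
  rintro ⟨x₀, f₀⟩
  rw [ContinuousAt, (schwartz_withSeminorms ℂ E ℂ).tendsto_nhds]
  rintro ⟨k, l⟩ ε hε
  let B : E × 𝓢(E, ℂ) → ℝ := fun p =>
    (1 + ‖p.1‖) ^ k * (2 ^ k * schwartzSup k l (p.2 - f₀)) +
      ‖p.1 - x₀‖ * ((1 + (‖p.1‖ + ‖x₀‖)) ^ k * (2 ^ k * schwartzSup k (l + 1) f₀))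
  have hB : Continuous B := by
    have : Continuous fun p : E × 𝓢(E, ℂ) => schwartzSup k l (p.2 - f₀) :=
      (continuous_schwartzSup k l).comp (continuous_snd.sub continuous_const)
    fun_prop
  have hB0 : B (x₀, f₀) = 0 := by simp [B]
  have h1 : ∀ᶠ p in 𝓝 (x₀, f₀), B p < ε := by
    have := hB.tendsto (x₀, f₀)
    rw [hB0] at this
    exact this.eventually (gt_mem_nhds hε)
  filter_upwards [h1] with p hp
  refine lt_of_le_of_lt ?_ hp
  have h2 : compSubConstCLM ℂ p.1 p.2 - compSubConstCLM ℂ x₀ f₀ =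
      compSubConstCLM ℂ p.1 (p.2 - f₀) +
        (compSubConstCLM ℂ p.1 f₀ - compSubConstCLM ℂ x₀ f₀) := by
    rw [map_sub]; abel
  change SchwartzMap.seminorm ℂ k l (compSubConstCLM ℂ p.1 p.2 - compSubConstCLM ℂ x₀ f₀) ≤ B p
  rw [h2]
  refine (map_add_le_add _ _ _).trans (add_le_add ?_ ?_)
  · exact seminorm_compSubConst_le k l p.1 _
  · exact seminorm_compSubConst_sub_le k l p.1 x₀ f₀

end Translation

section PolynomialGrowth

variable {E : Type*} [NormedAddCommGroup E] [NormedSpace ℝ E]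
  {Z : Type*} [NormedAddCommGroup Z]

/-- All Schwartz seminorms of the family grow at most polynomially in the parameter. -/
def PolyGrowth (F : Z → 𝓢(E, ℂ)) : Prop :=
  ∀ k l : ℕ, ∃ (C : ℝ) (N : ℕ), 0 ≤ C ∧ ∀ z, SchwartzMap.seminorm ℂ k l (F z) ≤ C * (1 + ‖z‖) ^ N

theorem PolyGrowth.finset_sup {F : Z → 𝓢(E, ℂ)} (hF : PolyGrowth F) (s : Finset (ℕ × ℕ)) :
    ∃ (C : ℝ) (N : ℕ), 0 ≤ C ∧
      ∀ z, s.sup (schwartzSeminormFamily ℂ E ℂ) (F z) ≤ C * (1 + ‖z‖) ^ N := by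
  induction s using Finset.induction_on with
  | empty => exact ⟨0, 0, le_rfl, fun z => by simp⟩
  | insert a s _ ih =>
    obtain ⟨C, N, hC, h⟩ := ih
    obtain ⟨C', N', hC', h'⟩ := hF a.1 a.2
    refine ⟨C + C', N + N', by positivity, fun z => ?_⟩
    have hz : 1 ≤ 1 + ‖z‖ := by simp
    rw [Finset.sup_insert]
    refine sup_le ((h' z).trans ?_) ((h z).trans ?_)
    · gcongr <;> linarith
    · gcongr <;> linarith

theorem PolyGrowth.clm {F : Z → 𝓢(E, ℂ)} (hF : PolyGrowth F) (L : 𝓢(E, ℂ) →L[ℂ] 𝓢(E, ℂ)) :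
    PolyGrowth fun z => L (F z) := by
  intro k l
  have hc : Continuous ((SchwartzMap.seminorm ℂ k l : Seminorm ℂ 𝓢(E, ℂ)).comp L.toLinearMap) :=
    (continuous_schwartzMap_seminorm k l).comp L.continuous
  obtain ⟨s, C, -, h⟩ := Seminorm.bound_of_continuous (schwartz_withSeminorms ℂ E ℂ) _ hc
  obtain ⟨C', N, hC', h'⟩ := hF.finset_sup s
  refine ⟨C * C', N, by positivity, fun z => (h (F z)).trans ?_⟩
  rw [mul_assoc]
  exact mul_le_mul_of_nonneg_left (h' z) C.2

theorem PolyGrowth.functional {F : Z → 𝓢(E, ℂ)} (hF : PolyGrowth F) (u : 𝓢(E, ℂ) →L[ℂ] ℂ) :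
    ∃ (C : ℝ) (N : ℕ), 0 ≤ C ∧ ∀ z, ‖u (F z)‖ ≤ C * (1 + ‖z‖) ^ N := by
  obtain ⟨s, C, hC, h⟩ := exists_norm_le_finset_sup_seminorm u
  obtain ⟨C', N, hC', h'⟩ := hF.finset_sup s
  refine ⟨C * C', N, by positivity, fun z => (h (F z)).trans ?_⟩
  rw [mul_assoc]
  exact mul_le_mul_of_nonneg_left (h' z) hC

theorem PolyGrowth.compSubConst {F : Z → 𝓢(E, ℂ)} (hF : PolyGrowth F) (a : Z → E)
    (ha : ∀ z, ‖a z‖ ≤ ‖z‖) : PolyGrowth fun z => compSubConstCLM ℂ (a z) (F z) := by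
  intro k l
  obtain ⟨C, N, hC, h⟩ := hF.finset_sup (Finset.Iic (k, l))
  refine ⟨2 ^ k * C, k + N, by positivity, fun z => ?_⟩
  refine (seminorm_compSubConst_le k l (a z) (F z)).trans ?_
  calc (1 + ‖a z‖) ^ k * (2 ^ k * schwartzSup k l (F z))
      ≤ (1 + ‖z‖) ^ k * (2 ^ k * (C * (1 + ‖z‖) ^ N)) := by
        have h1 := ha z
        have h2 : schwartzSup k l (F z) ≤ C * (1 + ‖z‖) ^ N := h z
        have h3 : 0 ≤ schwartzSup k l (F z) := apply_nonneg _ _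
        gcongr
    _ = _ := by rw [pow_add]; ring

theorem PolyGrowth.const (f : 𝓢(E, ℂ)) : PolyGrowth fun _ : Z => f := fun k l =>
  ⟨SchwartzMap.seminorm ℂ k l f, 0, apply_nonneg _ _, fun z => by simp⟩

end PolynomialGrowth

section TimeFrequency

variable {V : Type*} [NormedAddCommGroup V] [InnerProductSpace ℝ V] [FiniteDimensional ℝ V]
  [MeasurableSpace V] [BorelSpace V]

/-- The time-frequency shift `y ↦ e^{-2πi⟨y,η⟩} f(y - x)` for `z = (x, η)`. -/
def tfShift (z : V × V) : 𝓢(V, ℂ) →L[ℂ] 𝓢(V, ℂ) :=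
  fourierCLM ℂ 𝓢(V, ℂ) ∘L compSubConstCLM ℂ z.2 ∘L fourierInvCLM ℂ 𝓢(V, ℂ) ∘L
    compSubConstCLM ℂ z.1

theorem fourier_compSubConst_apply (a : V) (f : 𝓢(V, ℂ)) (y : V) :
    𝓕 (compSubConstCLM ℂ a f) y =
      Complex.exp (-(2 * Real.pi * ⟪a, y⟫ : ℝ) * Complex.I) * 𝓕 f y := by
  rw [fourier_coe, fourier_coe, Real.fourier_eq', Real.fourier_eq']
  have h : ∀ v, compSubConstCLM ℂ a f v = f (v - a) := fun v => compSubConstCLM_apply f a v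
  simp_rw [h, smul_eq_mul]
  rw [← integral_add_right_eq_self _ a, ← integral_const_mul]
  congr 1
  ext v
  rw [add_sub_cancel_right, ← mul_assoc, ← Complex.exp_add]
  congr 2
  rw [inner_add_left]
  push_cast
  ring

theorem tfShift_apply (z : V × V) (f : 𝓢(V, ℂ)) (y : V) :
    tfShift z f y = Complex.exp (-(2 * Real.pi * ⟪y, z.2⟫ : ℝ) * Complex.I) * f (y - z.1) := by
  have h : tfShift z f = 𝓕 (compSubConstCLM ℂ z.2 (𝓕⁻ (compSubConstCLM ℂ z.1 f))) := rfl
  rw [h, fourier_compSubConst_apply, FourierTransform.fourier_fourierInv_eq,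
    compSubConstCLM_apply, real_inner_comm]

theorem polyGrowth_tfShift (f : 𝓢(V, ℂ)) : PolyGrowth fun z : V × V => tfShift z f :=
  (((PolyGrowth.const f).compSubConst (fun z : V × V => z.1) norm_fst_le |>.clm
    (fourierInvCLM ℂ 𝓢(V, ℂ))).compSubConst (fun z : V × V => z.2) norm_snd_le).clm
      (fourierCLM ℂ 𝓢(V, ℂ))

theorem continuous_tfShift (f : 𝓢(V, ℂ)) : Continuous fun z : V × V => tfShift z f := by
  have h1 : Continuous fun z : V × V => compSubConstCLM ℂ z.1 f :=
    continuous_compSubConst.comp (continuous_fst.prodMk continuous_const)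
  have h2 := (fourierInvCLM ℂ 𝓢(V, ℂ)).continuous.comp h1
  have h3 := continuous_compSubConst.comp (continuous_snd.prodMk h2)
  exact (fourierCLM ℂ 𝓢(V, ℂ)).continuous.comp h3

theorem tfShift_tfShift (z z' : V × V) (f : 𝓢(V, ℂ)) :
    tfShift z (tfShift z' f) =
      Complex.exp ((2 * Real.pi * ⟪z.1, z'.2⟫ : ℝ) * Complex.I) • tfShift (z + z') f := by
  ext y
  simp only [tfShift_apply, smul_apply, smul_eq_mul, Prod.fst_add, Prod.snd_add]
  rw [← mul_assoc, ← mul_assoc, ← Complex.exp_add, ← Complex.exp_add, sub_sub]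
  congr 2
  rw [inner_add_right, inner_sub_left]
  push_cast
  ring

theorem norm_apply_tfShift_tfShift (u : 𝓢(V, ℂ) →L[ℂ] ℂ) (z z' : V × V) (f : 𝓢(V, ℂ)) :
    ‖u (tfShift z (tfShift z' f))‖ = ‖u (tfShift (z + z') f)‖ := by
  rw [tfShift_tfShift, map_smul, norm_smul, Complex.norm_exp_ofReal_mul_I, one_mul]

end TimeFrequency

end PhaseSpaceShifts

section WindowChange

open SchwartzMap LineDeriv Topology FourierTransform

theorem exists_one_add_pow_mul_exp_neg_rpow_le {p A : ℝ} (hp : 0 < p) (hA : 0 < A) (m : ℕ) :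
    ∃ C : ℝ, 0 < C ∧ ∀ t : ℝ, 0 ≤ t → (1 + t) ^ m * Real.exp (-A * t ^ p) ≤ C := by
  obtain ⟨n, hn⟩ := exists_nat_ge ((m : ℝ) / p)
  rw [div_le_iff₀ hp] at hn
  refine ⟨2 ^ m * (1 + n.factorial / A ^ n), by positivity, fun t ht => ?_⟩
  rcases le_total t 1 with h1 | h1
  · have h2 : Real.exp (-A * t ^ p) ≤ 1 := by
      rw [Real.exp_le_one_iff]
      have := Real.rpow_nonneg ht p
      nlinarith
    have h3 : (1 + t) ^ m ≤ 2 ^ m := by gcongr; linarith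
    have h4 : 0 ≤ (n.factorial : ℝ) / A ^ n := by positivity
    calc _ ≤ (2 : ℝ) ^ m * 1 := by gcongr
      _ ≤ _ := by gcongr; linarith
  · have h3 : (1 + t) ^ m ≤ 2 ^ m * t ^ m := by
      rw [← mul_pow]; gcongr; linarith
    have h4 : t ^ m ≤ (t ^ p) ^ n := by
      rw [← Real.rpow_natCast, ← Real.rpow_natCast, ← Real.rpow_mul ht]
      exact Real.rpow_le_rpow_of_exponent_le h1 (by linarith)
    have h5 := Real.pow_div_factorial_le_exp (A * t ^ p) (by positivity) n
    rw [mul_pow, div_le_iff₀ (by positivity)] at h5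
    have h6 : (t ^ p) ^ n ≤ n.factorial / A ^ n * Real.exp (A * t ^ p) := by
      rw [div_mul_eq_mul_div, le_div_iff₀ (by positivity)]
      linarith
    rw [neg_mul, Real.exp_neg, ← div_eq_mul_inv, div_le_iff₀ (Real.exp_pos _)]
    calc (1 + t) ^ m ≤ 2 ^ m * (n.factorial / A ^ n * Real.exp (A * t ^ p)) :=
          h3.trans (by gcongr; exact h4.trans h6)
      _ ≤ _ := by
        rw [← mul_assoc]
        gcongr
        linarith

theorem rpow_norm_le_of_le_add {p a b c : ℝ} (hp : 0 < p) (ha : 0 ≤ a) (hb : 0 ≤ b) (hc : 0 ≤ c)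
    (h : c ≤ a + b) : c ^ p ≤ 2 ^ p * (a ^ p + b ^ p) := by
  have h1 : c ≤ 2 * max a b := by
    linarith [le_max_left a b, le_max_right a b]
  have h2 : max a b ^ p ≤ a ^ p + b ^ p := by
    rcases le_total a b with h | h
    · rw [max_eq_right h]; linarith [Real.rpow_nonneg ha p]
    · rw [max_eq_left h]; linarith [Real.rpow_nonneg hb p]
  calc c ^ p ≤ (2 * max a b) ^ p := by gcongr
    _ = 2 ^ p * max a b ^ p := Real.mul_rpow (by norm_num) (le_max_of_le_left ha)
    _ ≤ _ := by gcongr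

/-- Decay faster than `exp (-A ‖x‖ ^ p)` for every `A`, on the set `Γ`. -/
def SuperDecayOn {X : Type*} [Norm X] (p : ℝ) (Γ : Set X) (f : X → ℂ) : Prop :=
  ∀ A : ℝ, 0 < A → ∃ C : ℝ, 0 ≤ C ∧ ∀ x ∈ Γ, ‖f x‖ ≤ C * Real.exp (-A * ‖x‖ ^ p)

variable {p : ℝ}

theorem integrable_one_add_norm_pow_inv {X : Type*} [NormedAddCommGroup X] [NormedSpace ℝ X]
    [FiniteDimensional ℝ X] [MeasurableSpace X] [BorelSpace X] (μ : Measure X)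
    [μ.IsAddHaarMeasure] :
    Integrable (fun x : X => ((1 + ‖x‖) ^ (Module.finrank ℝ X + 1))⁻¹) μ := by
  have h := integrable_one_add_norm (E := X) (μ := μ) (r := (Module.finrank ℝ X + 1 : ℕ))
    (by push_cast; linarith)
  refine h.congr (Eventually.of_forall fun x => ?_)
  simp only
  rw [Real.rpow_neg (by positivity), Real.rpow_natCast]

theorem SuperDecayOn.convolution_le {X : Type*} [NormedAddCommGroup X] [NormedSpace ℝ X]
    [FiniteDimensional ℝ X] [MeasurableSpace X] [BorelSpace X] {μ : Measure X}
    [μ.IsAddHaarMeasure] (hp : 0 < p) {f g : X → ℂ} (hf : SuperDecayOn p Set.univ f)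
    (hg : SuperDecayOn p Set.univ g) {A : ℝ} (hA : 0 < A) :
    ∃ C : ℝ, 0 ≤ C ∧ ∀ x, ∫ y, ‖f y‖ * ‖g (y - x)‖ ∂μ ≤ C * Real.exp (-A * ‖x‖ ^ p) := by
  have h2 : (0 : ℝ) < 2 ^ p := by positivity
  obtain ⟨C₁, hC₁, h₁⟩ := hf (A * 2 ^ p + 1) (by positivity)
  obtain ⟨C₂, hC₂, h₂⟩ := hg (A * 2 ^ p) (by positivity)
  obtain ⟨K, hK, h₃⟩ := exists_one_add_pow_mul_exp_neg_rpow_le hp one_pos (Module.finrank ℝ X + 1)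
  set w : X → ℝ := fun x => ((1 + ‖x‖) ^ (Module.finrank ℝ X + 1))⁻¹ with hw
  have hwi : Integrable w μ := integrable_one_add_norm_pow_inv μ
  refine ⟨C₁ * C₂ * K * ∫ y, w y ∂μ, mul_nonneg (by positivity)
    (integral_nonneg fun y => by positivity), fun x => ?_⟩
  rw [mul_right_comm, ← integral_const_mul]
  refine integral_mono_of_nonneg (Eventually.of_forall fun y => by positivity)
    (hwi.const_mul _) (Eventually.of_forall fun y => ?_)
  have h4 : Real.exp (-1 * ‖y‖ ^ p) ≤ K * w y := by
    rw [hw]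
    simp only
    rw [← div_eq_mul_inv, le_div_iff₀ (by positivity), mul_comm]
    exact h₃ _ (norm_nonneg y)
  have h5 : ‖x‖ ^ p ≤ 2 ^ p * (‖y‖ ^ p + ‖y - x‖ ^ p) := by
    refine rpow_norm_le_of_le_add hp (norm_nonneg _) (norm_nonneg _) (norm_nonneg _) ?_
    have := norm_sub_le y (y - x)
    rwa [sub_sub_cancel] at this
  have h6 : Real.exp (-(A * 2 ^ p + 1) * ‖y‖ ^ p) * Real.exp (-(A * 2 ^ p) * ‖y - x‖ ^ p) ≤
      Real.exp (-1 * ‖y‖ ^ p) * Real.exp (-A * ‖x‖ ^ p) := by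
    rw [← Real.exp_add, ← Real.exp_add, Real.exp_le_exp]
    nlinarith [mul_le_mul_of_nonneg_left h5 hA.le]
  calc ‖f y‖ * ‖g (y - x)‖
      ≤ (C₁ * Real.exp (-(A * 2 ^ p + 1) * ‖y‖ ^ p)) *
          (C₂ * Real.exp (-(A * 2 ^ p) * ‖y - x‖ ^ p)) :=
        mul_le_mul (h₁ y trivial) (h₂ _ trivial) (norm_nonneg _) (by positivity)
    _ = C₁ * C₂ * (Real.exp (-(A * 2 ^ p + 1) * ‖y‖ ^ p) *
          Real.exp (-(A * 2 ^ p) * ‖y - x‖ ^ p)) := by ring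
    _ ≤ C₁ * C₂ * (K * w y * Real.exp (-A * ‖x‖ ^ p)) := by
        refine mul_le_mul_of_nonneg_left (h6.trans ?_) (by positivity)
        gcongr
    _ = _ := by ring

/-- The complex conjugate of a Schwartz function. -/
def conjSchwartz {E : Type*} [NormedAddCommGroup E] [NormedSpace ℝ E] (f : 𝓢(E, ℂ)) : 𝓢(E, ℂ) :=
  SchwartzMap.postcompCLM Complex.conjCLE.toContinuousLinearMap f

theorem conjSchwartz_apply {E : Type*} [NormedAddCommGroup E] [NormedSpace ℝ E] (f : 𝓢(E, ℂ))
    (y : E) :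
    conjSchwartz f y = (starRingEnd ℂ) (f y) := by
  simp [conjSchwartz]

variable {V : Type*} [NormedAddCommGroup V] [InnerProductSpace ℝ V] [FiniteDimensional ℝ V]
  [MeasurableSpace V] [BorelSpace V]

/-- Schwartz functions which superdecay together with their Fourier transform. -/
def IsDecayWindow (p : ℝ) (f : 𝓢(V, ℂ)) : Prop :=
  SuperDecayOn p Set.univ f ∧ SuperDecayOn p Set.univ (𝓕 f : 𝓢(V, ℂ))

theorem fourierInv_apply_eq_fourier_neg (f : 𝓢(V, ℂ)) (y : V) : 𝓕⁻ f y = 𝓕 f (-y) := by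
  rw [fourier_coe, fourierInv_coe, Real.fourierInv_eq_fourier_neg]

theorem fourier_conjSchwartz_apply (f : 𝓢(V, ℂ)) (y : V) :
    𝓕 (conjSchwartz f) y = (starRingEnd ℂ) (𝓕 f (-y)) := by
  rw [fourier_coe, fourier_coe, Real.fourier_eq', Real.fourier_eq', ← integral_conj]
  congr 1
  ext v
  rw [conjSchwartz_apply, smul_eq_mul, smul_eq_mul, map_mul, ← Complex.exp_conj, map_mul,
    Complex.conj_ofReal, Complex.conj_I, inner_neg_right]
  push_cast
  ring_nf

theorem IsDecayWindow.conj {f : 𝓢(V, ℂ)} (hf : IsDecayWindow p f) :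
    IsDecayWindow p (conjSchwartz f) := by
  refine ⟨fun A hA => ?_, fun A hA => ?_⟩
  · obtain ⟨C, hC, h⟩ := hf.1 A hA
    refine ⟨C, hC, fun x hx => ?_⟩
    rw [conjSchwartz_apply, RCLike.norm_conj]
    exact h x hx
  · obtain ⟨C, hC, h⟩ := hf.2 A hA
    refine ⟨C, hC, fun x _ => ?_⟩
    rw [fourier_conjSchwartz_apply, RCLike.norm_conj, ← norm_neg x]
    exact h (-x) trivial

theorem norm_tfShift_apply (z : V × V) (f : 𝓢(V, ℂ)) (y : V) :
    ‖tfShift z f y‖ = ‖f (y - z.1)‖ := by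
  rw [tfShift_apply, norm_mul, ← Complex.ofReal_neg, Complex.norm_exp_ofReal_mul_I, one_mul]

theorem norm_fourier_compSubConst_apply (a : V) (f : 𝓢(V, ℂ)) (y : V) :
    ‖𝓕 (compSubConstCLM ℂ a f) y‖ = ‖𝓕 f y‖ := by
  rw [fourier_compSubConst_apply, norm_mul, ← Complex.ofReal_neg, Complex.norm_exp_ofReal_mul_I,
    one_mul]

theorem fourier_tfShift_apply (z : V × V) (f : 𝓢(V, ℂ)) (y : V) :
    𝓕 (tfShift z f) y = 𝓕 (compSubConstCLM ℂ z.1 f) (y + z.2) := by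
  rw [fourier_coe, fourier_coe, Real.fourier_eq', Real.fourier_eq']
  congr 1
  ext v
  rw [tfShift_apply, compSubConstCLM_apply, smul_eq_mul, smul_eq_mul, ← mul_assoc,
    ← Complex.exp_add, inner_add_right]
  congr 2
  push_cast
  ring_nf

/-- The pairing `f ↦ ∫ g f` with a fixed Schwartz function. -/
def pairingSchwartz (g : 𝓢(V, ℂ)) : 𝓢(V, ℂ) →L[ℂ] ℂ :=
  integralCLM ℂ volume ∘L pairing (ContinuousLinearMap.mul ℂ ℂ) g

theorem pairingSchwartz_apply (g f : 𝓢(V, ℂ)) : pairingSchwartz g f = ∫ y, g y * f y := by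
  simp [pairingSchwartz, integralCLM_apply, pairing_apply_apply]

/-- The short-time Fourier transform of `g` with window `conj h`, with the sign of the frequency
flipped. -/
def crossTransform (g h : 𝓢(V, ℂ)) (z : V × V) : ℂ :=
  pairingSchwartz g (tfShift (z.1, -z.2) h)

theorem continuous_crossTransform (g h : 𝓢(V, ℂ)) : Continuous (crossTransform g h) :=
  (pairingSchwartz g).continuous.comp ((continuous_tfShift h).comp
    (continuous_fst.prodMk continuous_snd.neg))

theorem norm_crossTransform_le (g h : 𝓢(V, ℂ)) (z : V × V) :
    ‖crossTransform g h z‖ ≤ ∫ y, ‖g y‖ * ‖h (y - z.1)‖ := by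
  rw [crossTransform, pairingSchwartz_apply]
  refine (norm_integral_le_integral_norm _).trans (le_of_eq ?_)
  congr 1
  ext y
  rw [norm_mul, norm_tfShift_apply]

theorem norm_crossTransform_le_fourier (g h : 𝓢(V, ℂ)) (z : V × V) :
    ‖crossTransform g h z‖ ≤ ∫ y, ‖𝓕⁻ g y‖ * ‖𝓕 h (y - z.2)‖ := by
  have h1 : crossTransform g h z = ∫ y, 𝓕⁻ g y * 𝓕 (tfShift (z.1, -z.2) h) y := by
    rw [crossTransform, pairingSchwartz_apply, ← SchwartzMap.integral_fourier_mul_eq,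
      FourierTransform.fourier_fourierInv_eq]
  rw [h1]
  refine (norm_integral_le_integral_norm _).trans (le_of_eq ?_)
  congr 1
  ext y
  rw [norm_mul, fourier_tfShift_apply, norm_fourier_compSubConst_apply,
    sub_eq_add_neg]

theorem superDecayOn_crossTransform (hp : 0 < p) {g h : 𝓢(V, ℂ)} (hg : IsDecayWindow p g)
    (hh : IsDecayWindow p h) : SuperDecayOn p Set.univ (crossTransform g h) := by
  intro A hA
  have hg' : SuperDecayOn p Set.univ (𝓕⁻ g : 𝓢(V, ℂ)) := fun A hA => by
    obtain ⟨C, hC, h⟩ := hg.2 A hA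
    refine ⟨C, hC, fun x _ => ?_⟩
    rw [fourierInv_apply_eq_fourier_neg, ← norm_neg x]
    exact h (-x) trivial
  obtain ⟨C₁, hC₁, h₁⟩ := hg.1.convolution_le (μ := volume) hp hh.1 hA
  obtain ⟨C₂, hC₂, h₂⟩ := hg'.convolution_le (μ := volume) hp hh.2 hA
  refine ⟨C₁ + C₂, by positivity, fun z _ => ?_⟩
  rcases le_total ‖z.1‖ ‖z.2‖ with hz | hz
  · have : ‖z‖ = ‖z.2‖ := by rw [Prod.norm_def, max_eq_right hz]
    rw [this]
    refine ((norm_crossTransform_le_fourier g h z).trans (h₂ z.2)).trans ?_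
    gcongr
    linarith
  · have : ‖z‖ = ‖z.1‖ := by rw [Prod.norm_def, max_eq_left hz]
    rw [this]
    refine ((norm_crossTransform_le g h z).trans (h₁ z.1)).trans ?_
    gcongr
    linarith

theorem SuperDecayOn.integrable_mul_of_le {X : Type*} [NormedAddCommGroup X] [NormedSpace ℝ X]
    [FiniteDimensional ℝ X] [MeasurableSpace X] [BorelSpace X] {μ : Measure X}
    [μ.IsAddHaarMeasure] (hp : 0 < p) {c : X → ℂ} (hc : SuperDecayOn p Set.univ c) {r : X → ℝ}
    (hm : AEStronglyMeasurable (fun x => ‖c x‖ * r x) μ) {C : ℝ} {N : ℕ} (hr0 : ∀ x, 0 ≤ r x)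
    (hr : ∀ x, r x ≤ C * (1 + ‖x‖) ^ N) :
    Integrable (fun x => ‖c x‖ * r x) μ := by
  obtain ⟨D, hD, h⟩ := hc 1 one_pos
  obtain ⟨K, hK, h₃⟩ := exists_one_add_pow_mul_exp_neg_rpow_le hp one_pos
    (N + (Module.finrank ℝ X + 1))
  have hC : 0 ≤ C := by
    have := (hr0 0).trans (hr 0)
    simpa using this
  refine ((integrable_one_add_norm_pow_inv μ).const_mul (D * C * K)).mono' hm
    (Eventually.of_forall fun x => ?_)
  rw [norm_mul, norm_norm, Real.norm_of_nonneg (hr0 x), ← div_eq_mul_inv,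
    le_div_iff₀ (by positivity)]
  calc ‖c x‖ * r x * (1 + ‖x‖) ^ (Module.finrank ℝ X + 1)
      ≤ (D * Real.exp (-1 * ‖x‖ ^ p)) * (C * (1 + ‖x‖) ^ N) *
          (1 + ‖x‖) ^ (Module.finrank ℝ X + 1) := by
        have h1 := h x trivial
        have h2 := hr x
        have h3 := hr0 x
        gcongr
    _ = D * C * ((1 + ‖x‖) ^ (N + (Module.finrank ℝ X + 1)) * Real.exp (-1 * ‖x‖ ^ p)) := by
        rw [pow_add]; ring
    _ ≤ D * C * K := by
        gcongr
        exact h₃ _ (norm_nonneg x)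

theorem integral_mul_conj_pos {f : 𝓢(V, ℂ)} (hf : f ≠ 0) :
    (∫ y, conjSchwartz f y * f y) ≠ 0 := by
  have h1 : ∀ y, conjSchwartz f y * f y = ((‖f y‖ ^ 2 : ℝ) : ℂ) := fun y => by
    rw [conjSchwartz_apply, mul_comm, Complex.mul_conj, Complex.normSq_eq_norm_sq]
  simp_rw [h1]
  rw [integral_complex_ofReal]
  have hne : ∃ y, f y ≠ 0 := by
    by_contra! h
    exact hf (by ext y; simpa using h y)
  obtain ⟨y, hy⟩ := hne
  have hint : Integrable fun y => ‖f y‖ ^ 2 := by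
    have : Integrable fun y => conjSchwartz f y * f y :=
      (pairing (ContinuousLinearMap.mul ℂ ℂ) (conjSchwartz f) f).integrable
    simp_rw [h1] at this
    have h2 := this.re
    simp only [RCLike.re_to_complex, Complex.ofReal_re] at h2
    exact h2
  have hpos : 0 < ∫ y, ‖f y‖ ^ 2 :=
    integral_pos_of_integrable_nonneg_nonzero (x := y) (by have := f.continuous; fun_prop) hint
      (fun y => by positivity) (by positivity)
  exact_mod_cast hpos.ne'

theorem isAddHaarMeasure_volume_prod : (volume : Measure (V × V)).IsAddHaarMeasure := by
  rw [Measure.volume_eq_prod]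
  infer_instance

/-- Change of window: the reproducing formula, as an inequality. -/
theorem norm_apply_tfShift_le_integral (hp : 0 < p) {f g : 𝓢(V, ℂ)} (hf : IsDecayWindow p f)
    (hg : IsDecayWindow p g) (u : 𝓢(V, ℂ) →L[ℂ] ℂ) (z : V × V) :
    ‖∫ y, conjSchwartz f y * f y‖ * ‖u (tfShift z g)‖ ≤
      ∫ z', ‖crossTransform g (conjSchwartz f) z'‖ * ‖u (tfShift (z + z') f)‖ := by
  have := isAddHaarMeasure_volume_prod (V := V)
  set c := crossTransform g (conjSchwartz f) with hc
  have hcc : Continuous c := continuous_crossTransform g _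
  have hcd : SuperDecayOn p Set.univ c := superDecayOn_crossTransform hp hg hf.conj
  let F : V × V → 𝓢(V, ℂ) := fun z' => c z' • tfShift z' f
  have hF : Continuous F := hcc.smul (continuous_tfShift f)
  have hint : ∀ k l, Integrable fun z' => SchwartzMap.seminorm ℂ k l (F z') := fun k l => by
    obtain ⟨C, N, -, h⟩ := polyGrowth_tfShift f k l
    simp only [F, map_smul_eq_mul]
    refine hcd.integrable_mul_of_le hp (Continuous.aestronglyMeasurable ?_)
      (fun _ => apply_nonneg _ _) h
    exact hcc.norm.mul ((continuous_schwartzMap_seminorm k l).comp (continuous_tfShift f))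
  have hG : ∀ y, ((∫ y, conjSchwartz f y * f y) • g) y = ∫ z', F z' y := by
    intro y
    have hFi : Integrable fun z' => F z' y :=
      (hint 0 0).mono' ((continuous_eval_schwartzMap y).comp hF).aestronglyMeasurable
        (Eventually.of_forall fun z' => SchwartzMap.norm_le_seminorm ℂ _ _)
    rw [Measure.volume_eq_prod] at hFi ⊢
    rw [integral_prod _ hFi]
    have inner : ∀ x : V, ∫ η : V, F (x, η) y = g y * (conjSchwartz f (y - x) * f (y - x)) := by
      intro x
      let P : 𝓢(V, ℂ) := pairing (ContinuousLinearMap.mul ℂ ℂ) g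
        (compSubConstCLM ℂ x (conjSchwartz f))
      have hP : ∀ v, P v = g v * conjSchwartz f (v - x) := fun v => by
        simp [P, pairing_apply_apply, compSubConstCLM_apply]
      have h1 : ∀ η, c (x, η) = 𝓕⁻ P η := fun η => by
        rw [fourierInv_coe, Real.fourierInv_eq', hc, crossTransform, pairingSchwartz_apply]
        congr 1
        ext v
        rw [tfShift_apply, hP, smul_eq_mul, inner_neg_right]
        push_cast
        ring_nf
      have h2 : ∫ η : V, F (x, η) y = 𝓕 (𝓕⁻ P) y * f (y - x) := by
        rw [fourier_coe, Real.fourier_eq', ← integral_mul_const]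
        congr 1
        ext η
        simp only [F, smul_apply, smul_eq_mul, tfShift_apply, h1]
        rw [real_inner_comm]
        push_cast
        ring_nf
      rw [h2, FourierTransform.fourier_fourierInv_eq, hP]
      ring
    simp_rw [inner]
    rw [integral_const_mul, integral_sub_left_eq_self (fun v => conjSchwartz f v * f v) volume y,
      smul_apply, smul_eq_mul, mul_comm]
  have key := map_eq_integral_schwartzMap (u ∘L tfShift z) F hF hint _ hG
  rw [map_smul, smul_eq_mul] at key
  simp only [ContinuousLinearMap.comp_apply] at key
  rw [← norm_mul, key]
  refine (norm_integral_le_integral_norm _).trans (le_of_eq ?_)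
  congr 1
  ext z'
  simp only [F]
  rw [map_smul, map_smul, norm_smul, norm_apply_tfShift_tfShift]

end WindowChange

section ConicDecay

open SchwartzMap Topology

theorem norm_le_pnorm {d : ℕ} (z : Ed d × Ed d) : ‖z‖ ≤ pnorm z := by
  rw [Prod.norm_def, pnorm]
  exact max_le (Real.le_sqrt_of_sq_le (by nlinarith [sq_nonneg ‖z.2‖]))
    (Real.le_sqrt_of_sq_le (by nlinarith [sq_nonneg ‖z.1‖]))

theorem pnorm_le_two_mul_norm {d : ℕ} (z : Ed d × Ed d) : pnorm z ≤ 2 * ‖z‖ := by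
  have h1 := norm_fst_le z
  have h2 := norm_snd_le z
  rw [pnorm]
  refine Real.sqrt_le_iff.2 ⟨by positivity, ?_⟩
  nlinarith [norm_nonneg z.1, norm_nonneg z.2, norm_nonneg z]

theorem mem_WFs_iff {d : ℕ} {s : ℝ} (hs : 0 < s) (W : Ed d × Ed d → ℂ) (z₀ : Ed d × Ed d) :
    z₀ ∈ WFs s W ↔ z₀ ≠ 0 ∧ ¬ ∃ Γ : Set (Ed d × Ed d), IsOpen Γ ∧ IsConic Γ ∧
      (0 : Ed d × Ed d) ∉ Γ ∧ z₀ ∈ Γ ∧ SuperDecayOn (1 / s) Γ W := by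
  have hp : 0 < 1 / s := by positivity
  have key : ∀ Γ : Set (Ed d × Ed d), (∀ A : ℝ, 0 < A → ∃ C : ℝ, ∀ z ∈ Γ,
      Real.exp (A * pnorm z ^ (1/s)) * ‖W z‖ ≤ C) ↔ SuperDecayOn (1 / s) Γ W := by
    intro Γ
    constructor
    · intro h A hA
      obtain ⟨C, hC⟩ := h A hA
      refine ⟨max C 0, le_max_right _ _, fun z hz => ?_⟩
      have h1 := norm_le_pnorm z
      rw [neg_mul, Real.exp_neg, ← div_eq_mul_inv, le_div_iff₀ (Real.exp_pos _), mul_comm]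
      refine le_trans ?_ ((hC z hz).trans (le_max_left _ _))
      gcongr
    · intro h A hA
      obtain ⟨C, hC, h⟩ := h (A * 2 ^ (1 / s)) (by positivity)
      refine ⟨C, fun z hz => ?_⟩
      rw [← le_div_iff₀' (Real.exp_pos _), div_eq_mul_inv, ← Real.exp_neg]
      refine (h z hz).trans ?_
      gcongr
      rw [neg_mul, neg_le_neg_iff, mul_assoc, ← Real.mul_rpow (by norm_num) (norm_nonneg z)]
      have h1 := pnorm_le_two_mul_norm z
      have h2 : 0 ≤ pnorm z := Real.sqrt_nonneg _
      gcongr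
  simp only [WFs, Set.mem_ofPred_eq, key]

variable {X : Type*} [NormedAddCommGroup X] [NormedSpace ℝ X] {p : ℝ}

theorem exists_isConic_add_mem {Γ : Set X} (hΓ : IsOpen Γ) (hc : IsConic Γ) {z₀ : X}
    (h0 : z₀ ≠ 0) (hz₀ : z₀ ∈ Γ) :
    ∃ (Γ' : Set X) (ε : ℝ), 0 < ε ∧ IsOpen Γ' ∧ IsConic Γ' ∧ (0 : X) ∉ Γ' ∧ z₀ ∈ Γ' ∧
      ∀ z ∈ Γ', ∀ z', ‖z'‖ < ε * ‖z‖ → z + z' ∈ Γ := by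
  obtain ⟨ρ, hρ, hball⟩ := Metric.isOpen_iff.1 hΓ z₀ hz₀
  have hz := norm_pos_iff.2 h0
  set r := min (ρ / 2) (‖z₀‖ / 2) with hr
  have hr0 : 0 < r := lt_min (by positivity) (by positivity)
  have hr1 : 2 * r ≤ ρ := by linarith [min_le_left (ρ / 2) (‖z₀‖ / 2)]
  have hr2 : r < ‖z₀‖ := by linarith [min_le_right (ρ / 2) (‖z₀‖ / 2)]
  refine ⟨{z | ∃ t : ℝ, 0 < t ∧ ‖t • z - z₀‖ < r}, r / (‖z₀‖ + r), by positivity,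
    ?_, ?_, ?_, ?_, ?_⟩
  · have : {z | ∃ t : ℝ, 0 < t ∧ ‖t • z - z₀‖ < r} =
        ⋃ t ∈ Set.Ioi (0 : ℝ), {z | ‖t • z - z₀‖ < r} := by
      ext z; simp
    rw [this]
    exact isOpen_biUnion fun t _ => isOpen_lt (by fun_prop) continuous_const
  · rintro a ha z ⟨t, ht, h⟩
    refine ⟨t / a, by positivity, ?_⟩
    rwa [smul_smul, div_mul_cancel₀ _ ha.ne']
  · rintro ⟨t, ht, h⟩
    rw [smul_zero, zero_sub, norm_neg] at h
    linarith
  · exact ⟨1, one_pos, by simpa using hr0⟩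
  · rintro z ⟨t, ht, h⟩ z' hz'
    have h1 : t * ‖z‖ ≤ ‖z₀‖ + r := by
      have := norm_le_norm_add_norm_sub' (t • z) z₀
      rw [norm_smul, Real.norm_of_nonneg ht.le] at this
      linarith
    have h2 : t * ‖z'‖ < r := by
      rw [div_mul_eq_mul_div, lt_div_iff₀ (by positivity)] at hz'
      have h3 : t * ‖z'‖ * (‖z₀‖ + r) < r * (‖z₀‖ + r) := by
        calc t * ‖z'‖ * (‖z₀‖ + r) = t * (‖z'‖ * (‖z₀‖ + r)) := by ring
          _ < t * (r * ‖z‖) := by gcongr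
          _ = r * (t * ‖z‖) := by ring
          _ ≤ _ := by gcongr
      exact lt_of_mul_lt_mul_right h3 (by positivity)
    have h3 : t • (z + z') ∈ Γ := by
      refine hball ?_
      rw [mem_ball_iff_norm]
      have : t • (z + z') - z₀ = (t • z - z₀) + t • z' := by rw [smul_add]; abel
      rw [this]
      refine (norm_add_le _ _).trans_lt ?_
      rw [norm_smul, Real.norm_of_nonneg ht.le]
      linarith
    have := hc t⁻¹ (by positivity) _ h3
    rwa [smul_smul, inv_mul_cancel₀ ht.ne', one_smul] at this

theorem exists_superDecayOn_of_le_integral [FiniteDimensional ℝ X] [MeasurableSpace X]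
    [BorelSpace X] {μ : Measure X} [μ.IsAddHaarMeasure] (hp : 0 < p) {c W₁ W₂ : X → ℂ}
    (hc : SuperDecayOn p Set.univ c) {C₁ : ℝ} {N : ℕ} (hC₁ : 0 ≤ C₁)
    (hW₁ : ∀ z, ‖W₁ z‖ ≤ C₁ * (1 + ‖z‖) ^ N) {κ : ℝ} (hκ : 0 < κ)
    (hle : ∀ z, κ * ‖W₂ z‖ ≤ ∫ z', ‖c z'‖ * ‖W₁ (z + z')‖ ∂μ) {Γ : Set X}
    (hΓ : IsOpen Γ) (hΓc : IsConic Γ) {z₀ : X} (h0 : z₀ ≠ 0) (hz₀ : z₀ ∈ Γ)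
    (h : SuperDecayOn p Γ W₁) :
    ∃ Γ' : Set X, IsOpen Γ' ∧ IsConic Γ' ∧ (0 : X) ∉ Γ' ∧ z₀ ∈ Γ' ∧ SuperDecayOn p Γ' W₂ := by
  obtain ⟨Γ', ε, hε, h1, h2, h3, h4, h5⟩ := exists_isConic_add_mem hΓ hΓc h0 hz₀
  refine ⟨Γ', h1, h2, h3, h4, fun A hA => ?_⟩
  set A₁ := A * 2 ^ p with hA₁
  set A₂ := A * (ε⁻¹) ^ p with hA₂
  have hA₁0 : 0 < A₁ := by positivity
  have hA₂0 : 0 < A₂ := by positivity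
  obtain ⟨D₁, hD₁, hd₁⟩ := h A₁ hA₁0
  obtain ⟨D₂, hD₂, hd₂⟩ := hc (A₁ + A₂ + 1) (by positivity)
  obtain ⟨K, hK, hk⟩ := exists_one_add_pow_mul_exp_neg_rpow_le hp one_pos
    (N + (Module.finrank ℝ X + 1))
  set w : X → ℝ := fun x => ((1 + ‖x‖) ^ (Module.finrank ℝ X + 1))⁻¹ with hw
  have hwi : Integrable w μ := integrable_one_add_norm_pow_inv μ
  set D := D₂ * (D₁ + C₁ * (1 + ε⁻¹) ^ N) with hD
  have hD0 : 0 ≤ D := by positivity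
  refine ⟨κ⁻¹ * (D * K * ∫ y, w y ∂μ), mul_nonneg (by positivity) (mul_nonneg (by positivity)
    (integral_nonneg fun y => by positivity)), fun z hz => ?_⟩
  rw [mul_assoc, ← div_eq_inv_mul, le_div_iff₀' hκ]
  refine (hle z).trans ?_
  rw [mul_right_comm, ← integral_const_mul]
  refine integral_mono_of_nonneg (Eventually.of_forall fun y => by positivity)
    (hwi.const_mul _) (Eventually.of_forall fun z' => ?_)
  have hexp : Real.exp (-1 * ‖z'‖ ^ p) * (1 + ‖z'‖) ^ N ≤ K * w z' := by
    rw [hw]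
    simp only
    rw [← div_eq_mul_inv, le_div_iff₀ (by positivity)]
    have := hk _ (norm_nonneg z')
    rw [pow_add] at this
    linarith
  have hz'p : 0 ≤ ‖z'‖ ^ p := by positivity
  have hone : (1 : ℝ) ≤ (1 + ‖z'‖) ^ N := one_le_pow₀ (by linarith [norm_nonneg z'])
  have hmain : ‖c z'‖ * ‖W₁ (z + z')‖ ≤
      D * (Real.exp (-A * ‖z‖ ^ p) * (Real.exp (-1 * ‖z'‖ ^ p) * (1 + ‖z'‖) ^ N)) := by
    rcases lt_or_ge ‖z'‖ (ε * ‖z‖) with hlt | hge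
    · have h6 := hd₁ _ (h5 z hz z' hlt)
      have h7 : ‖z‖ ^ p ≤ 2 ^ p * (‖z + z'‖ ^ p + ‖z'‖ ^ p) := by
        refine rpow_norm_le_of_le_add hp (norm_nonneg _) (norm_nonneg _) (norm_nonneg _) ?_
        have := norm_sub_le (z + z') z'
        rwa [add_sub_cancel_right] at this
      have h8 : Real.exp (-(A₁ + A₂ + 1) * ‖z'‖ ^ p) * Real.exp (-A₁ * ‖z + z'‖ ^ p) ≤
          Real.exp (-A * ‖z‖ ^ p) * Real.exp (-1 * ‖z'‖ ^ p) := by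
        rw [← Real.exp_add, ← Real.exp_add, Real.exp_le_exp]
        nlinarith [mul_le_mul_of_nonneg_left h7 hA.le, mul_nonneg hA₂0.le hz'p]
      calc ‖c z'‖ * ‖W₁ (z + z')‖
          ≤ (D₂ * Real.exp (-(A₁ + A₂ + 1) * ‖z'‖ ^ p)) *
              (D₁ * Real.exp (-A₁ * ‖z + z'‖ ^ p)) :=
            mul_le_mul (hd₂ z' trivial) h6 (norm_nonneg _) (by positivity)
        _ = D₂ * D₁ * (Real.exp (-(A₁ + A₂ + 1) * ‖z'‖ ^ p) *
              Real.exp (-A₁ * ‖z + z'‖ ^ p)) := by ring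
        _ ≤ D₂ * D₁ * ((Real.exp (-A * ‖z‖ ^ p) * Real.exp (-1 * ‖z'‖ ^ p)) * 1) := by
            rw [mul_one]; gcongr
        _ ≤ D * ((Real.exp (-A * ‖z‖ ^ p) * Real.exp (-1 * ‖z'‖ ^ p)) * (1 + ‖z'‖) ^ N) := by
            gcongr
            rw [hD]
            gcongr
            linarith [show 0 ≤ C₁ * (1 + ε⁻¹) ^ N by positivity]
        _ = _ := by ring
    · have h6 : ‖z‖ ≤ ε⁻¹ * ‖z'‖ := by
        rw [inv_mul_eq_div, le_div_iff₀ hε]; linarith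
      have h7 : ‖W₁ (z + z')‖ ≤ C₁ * (1 + ε⁻¹) ^ N * (1 + ‖z'‖) ^ N := by
        refine (hW₁ _).trans ?_
        rw [mul_assoc, ← mul_pow]
        gcongr
        have := norm_add_le z z'
        nlinarith [inv_pos.2 hε]
      have h8 : ‖z‖ ^ p ≤ (ε⁻¹) ^ p * ‖z'‖ ^ p := by
        rw [← Real.mul_rpow (by positivity) (by positivity)]
        gcongr
      have h9 : Real.exp (-(A₁ + A₂ + 1) * ‖z'‖ ^ p) ≤
          Real.exp (-A * ‖z‖ ^ p) * Real.exp (-1 * ‖z'‖ ^ p) := by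
        rw [← Real.exp_add, Real.exp_le_exp]
        nlinarith [mul_le_mul_of_nonneg_left h8 hA.le, mul_nonneg hA₁0.le hz'p]
      calc ‖c z'‖ * ‖W₁ (z + z')‖
          ≤ (D₂ * Real.exp (-(A₁ + A₂ + 1) * ‖z'‖ ^ p)) *
              (C₁ * (1 + ε⁻¹) ^ N * (1 + ‖z'‖) ^ N) :=
            mul_le_mul (hd₂ z' trivial) h7 (norm_nonneg _) (by positivity)
        _ ≤ (D₂ * (Real.exp (-A * ‖z‖ ^ p) * Real.exp (-1 * ‖z'‖ ^ p))) *
              (C₁ * (1 + ε⁻¹) ^ N * (1 + ‖z'‖) ^ N) := by gcongr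
        _ = D₂ * (C₁ * (1 + ε⁻¹) ^ N) *
            (Real.exp (-A * ‖z‖ ^ p) * (Real.exp (-1 * ‖z'‖ ^ p) * (1 + ‖z'‖) ^ N)) := by ring
        _ ≤ _ := by
            gcongr
            rw [hD]
            gcongr
            linarith
  refine hmain.trans ?_
  calc _ ≤ D * (Real.exp (-A * ‖z‖ ^ p) * (K * w z')) := by gcongr
    _ = _ := by ring

theorem WFs_tfShift_subset {d : ℕ} {s : ℝ} (hs : 0 < s) (u : TD d) {f g : 𝓢(Ed d, ℂ)}
    (hf : IsDecayWindow (1 / s) f) (hg : IsDecayWindow (1 / s) g) (hf0 : f ≠ 0) :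
    WFs s (fun z => u (tfShift z g)) ⊆ WFs s (fun z => u (tfShift z f)) := by
  have := isAddHaarMeasure_volume_prod (V := Ed d)
  have hp : 0 < 1 / s := by positivity
  intro z₀
  rw [mem_WFs_iff hs, mem_WFs_iff hs]
  refine fun ⟨h0, hn⟩ => ⟨h0, fun ⟨Γ, hΓ, hΓc, _, hz₀, h⟩ => hn ?_⟩
  obtain ⟨C, N, hC, hle⟩ := (polyGrowth_tfShift f).functional u
  exact exists_superDecayOn_of_le_integral (μ := volume) hp
    (superDecayOn_crossTransform hp hg hf.conj) hC hle (norm_pos_iff.2 (integral_mul_conj_pos hf0))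
    (fun z => norm_apply_tfShift_le_integral hp hf hg u z) hΓ hΓc h0 hz₀ h

/-- The wave front set does not depend on the window. -/
theorem WFs_tfShift_eq {d : ℕ} {s : ℝ} (hs : 0 < s) (u : TD d) {f g : 𝓢(Ed d, ℂ)}
    (hf : IsDecayWindow (1 / s) f) (hg : IsDecayWindow (1 / s) g) (hf0 : f ≠ 0) (hg0 : g ≠ 0) :
    WFs s (fun z => u (tfShift z f)) = WFs s (fun z => u (tfShift z g)) :=
  (WFs_tfShift_subset hs u hg hf hg0).antisymm (WFs_tfShift_subset hs u hf hg hf0)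

theorem mem_WFs_of_norm_comp_eq {d : ℕ} {s : ℝ} (hs : 0 < s) {W W' : Ed d × Ed d → ℂ}
    (L : (Ed d × Ed d) ≃L[ℝ] (Ed d × Ed d)) (h : ∀ z, ‖W' z‖ = ‖W (L z)‖) {z₀ : Ed d × Ed d}
    (hz₀ : z₀ ∈ WFs s W') : L z₀ ∈ WFs s W := by
  have hp : 0 < 1 / s := by positivity
  rw [mem_WFs_iff hs] at hz₀ ⊢
  refine ⟨by simpa using hz₀.1, fun ⟨Γ, hΓ, hΓc, h0, hz, hd⟩ => hz₀.2
    ⟨L ⁻¹' Γ, hΓ.preimage L.continuous, fun t ht z hz => ?_, by simpa using h0, hz,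
      fun A hA => ?_⟩⟩
  · rw [Set.mem_preimage, map_smul]
    exact hΓc t ht _ hz
  · set M := ‖(L.symm : (Ed d × Ed d) →L[ℝ] (Ed d × Ed d))‖ + 1 with hM
    have hM0 : 0 < M := by positivity
    obtain ⟨C, hC, hd⟩ := hd (A * M ^ (1 / s)) (by positivity)
    refine ⟨C, hC, fun z hz => ?_⟩
    rw [h]
    refine (hd _ hz).trans (mul_le_mul_of_nonneg_left (Real.exp_le_exp.2 ?_) hC)
    rw [neg_mul, neg_mul, neg_le_neg_iff, mul_assoc, ← Real.mul_rpow hM0.le (norm_nonneg _)]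
    gcongr
    have h1 := (L.symm : (Ed d × Ed d) →L[ℝ] (Ed d × Ed d)).le_opNorm (L z)
    simp only [ContinuousLinearEquiv.coe_coe, ContinuousLinearEquiv.symm_apply_apply] at h1
    refine h1.trans ?_
    gcongr
    linarith

theorem mem_WFs_iff_of_norm_comp_eq {d : ℕ} {s : ℝ} (hs : 0 < s) {W W' : Ed d × Ed d → ℂ}
    (L : (Ed d × Ed d) ≃L[ℝ] (Ed d × Ed d)) (h : ∀ z, ‖W' z‖ = ‖W (L z)‖) (z₀ : Ed d × Ed d) :
    z₀ ∈ WFs s W' ↔ L z₀ ∈ WFs s W := by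
  refine ⟨mem_WFs_of_norm_comp_eq hs L h, fun hz => ?_⟩
  have := mem_WFs_of_norm_comp_eq (W' := W) (W := W') hs L.symm (fun z => by simp [h]) hz
  simpa using this

end ConicDecay

section SchwartzCriterion

open SchwartzMap LineDeriv Topology FourierTransform
open scoped ContDiff

variable {d : ℕ}

theorem contDiff_pdGS (i : Fin d) {f : Ed d → ℂ} (hf : ContDiff ℝ ∞ f) :
    ContDiff ℝ ∞ (pdGS i f) :=
  (hf.fderiv_right (m := ∞) (by simp)).clm_apply contDiff_const

theorem fderiv_eq_sum_pdGS (f : Ed d → ℂ) (x : Ed d) :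
    fderiv ℝ f x = ∑ i, (EuclideanSpace.proj i : Ed d →L[ℝ] ℝ).smulRight (pdGS i f x) := by
  ext v
  conv_lhs => rw [← (EuclideanSpace.basisFun (Fin d) ℝ).sum_repr v]
  simp [pdGS]

theorem exists_norm_pow_mul_iteratedFDeriv_le {S : Set (Ed d → ℂ)}
    (hS : ∀ f ∈ S, ContDiff ℝ ∞ f) (hd : ∀ f ∈ S, ∀ i, pdGS i f ∈ S)
    (hb : ∀ f ∈ S, ∀ k : ℕ, ∃ C : ℝ, ∀ x, ‖x‖ ^ k * ‖f x‖ ≤ C) {f : Ed d → ℂ} (hf : f ∈ S)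
    (k n : ℕ) : ∃ C : ℝ, ∀ x, ‖x‖ ^ k * ‖iteratedFDeriv ℝ n f x‖ ≤ C := by
  induction n generalizing f with
  | zero => simpa using hb f hf k
  | succ n ih =>
    choose C hC using fun i => ih (hd f hf i)
    let L : Fin d → ℂ →L[ℝ] (Ed d →L[ℝ] ℂ) := fun i =>
      ContinuousLinearMap.smulRightL ℝ (Ed d) ℂ (EuclideanSpace.proj i)
    have hL : fderiv ℝ f = ∑ i, (L i ∘ pdGS i f) := by
      ext1 x
      rw [fderiv_eq_sum_pdGS, Finset.sum_apply]
      rfl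
    have hsm : ∀ i, ContDiff ℝ n (pdGS i f) := fun i =>
      (contDiff_pdGS i (hS f hf)).of_le (mod_cast le_top)
    refine ⟨∑ i, ‖L i‖ * C i, fun x => ?_⟩
    rw [← norm_iteratedFDeriv_fderiv, hL,
      iteratedFDeriv_sum_apply fun i _ => ((L i).contDiff.comp (hsm i)).contDiffAt]
    refine (mul_le_mul_of_nonneg_left (norm_sum_le _ _) (by positivity)).trans ?_
    rw [Finset.mul_sum]
    refine Finset.sum_le_sum fun i _ => ?_
    have h1 := (L i).norm_iteratedFDeriv_comp_left (hsm i).contDiffAt (le_refl (n : WithTop ℕ∞))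
      (x := x)
    calc _ ≤ ‖x‖ ^ k * (‖L i‖ * ‖iteratedFDeriv ℝ n (pdGS i f) x‖) := by gcongr
      _ = ‖L i‖ * (‖x‖ ^ k * ‖iteratedFDeriv ℝ n (pdGS i f) x‖) := by ring
      _ ≤ _ := by gcongr; exact hC i x

theorem exists_schwartzMap_eq {S : Set (Ed d → ℂ)}
    (hS : ∀ f ∈ S, ContDiff ℝ ∞ f) (hd : ∀ f ∈ S, ∀ i, pdGS i f ∈ S)
    (hb : ∀ f ∈ S, ∀ k : ℕ, ∃ C : ℝ, ∀ x, ‖x‖ ^ k * ‖f x‖ ≤ C) {f : Ed d → ℂ} (hf : f ∈ S) :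
    ∃ F : 𝓢(Ed d, ℂ), ∀ x, F x = f x :=
  ⟨⟨f, hS f hf, exists_norm_pow_mul_iteratedFDeriv_le hS hd hb hf⟩, fun _ => rfl⟩

theorem pdGS_comm (i j : Fin d) {f : Ed d → ℂ} (hf : ContDiff ℝ ∞ f) :
    pdGS i (pdGS j f) = pdGS j (pdGS i f) := by
  have hd : Differentiable ℝ (fderiv ℝ f) :=
    (hf.fderiv_right (m := ∞) (by simp)).differentiable (by simp)
  have h : ∀ i j x, pdGS i (pdGS j f) x =
      fderiv ℝ (fderiv ℝ f) x (EuclideanSpace.single i 1) (EuclideanSpace.single j 1) := by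
    intro i j x
    have : HasFDerivAt (pdGS j f)
        ((fderiv ℝ (fderiv ℝ f) x).flip (EuclideanSpace.single j 1)) x := by
      have h := (hd x).hasFDerivAt.clm_apply
        (hasFDerivAt_const (EuclideanSpace.single j (1 : ℝ)) x)
      rw [ContinuousLinearMap.comp_zero, zero_add] at h
      exact h
    rw [pdGS, this.fderiv]
    rfl
  ext x
  rw [h, h]
  exact (hf.contDiffAt.isSymmSndFDerivAt (by
    simpa using WithTop.coe_le_coe.2 (le_top : (2 : ℕ∞) ≤ ⊤))) _ _

theorem contDiff_iterate_pdGS (i : Fin d) (n : ℕ) {f : Ed d → ℂ} (hf : ContDiff ℝ ∞ f) :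
    ContDiff ℝ ∞ ((pdGS i)^[n] f) := by
  induction n with
  | zero => exact hf
  | succ n ih =>
    rw [Function.iterate_succ_apply']
    exact contDiff_pdGS i ih

theorem pdGS_iterate_comm (i j : Fin d) (n : ℕ) {f : Ed d → ℂ} (hf : ContDiff ℝ ∞ f) :
    pdGS i ((pdGS j)^[n] f) = (pdGS j)^[n] (pdGS i f) := by
  induction n with
  | zero => rfl
  | succ n ih =>
    rw [Function.iterate_succ_apply', Function.iterate_succ_apply',
      pdGS_comm i j (contDiff_iterate_pdGS j n hf), ih]

/-- The composition of the iterated partial derivatives with indices in the list `l`. -/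
def listDeriv (l : List (Fin d)) (β : Fin d → ℕ) (f : Ed d → ℂ) : Ed d → ℂ :=
  ((l.map fun i => (pdGS i)^[β i]).foldr (· ∘ ·) id) f

theorem listDeriv_cons (j : Fin d) (l : List (Fin d)) (β : Fin d → ℕ) (f : Ed d → ℂ) :
    listDeriv (j :: l) β f = (pdGS j)^[β j] (listDeriv l β f) := rfl

theorem mderiv_eq_listDeriv (β : Fin d → ℕ) (f : Ed d → ℂ) :
    mderiv β f = listDeriv (List.finRange d) β f := by
  rw [mderiv, listDeriv, List.ofFn_eq_map]

theorem contDiff_listDeriv (l : List (Fin d)) (β : Fin d → ℕ) {f : Ed d → ℂ}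
    (hf : ContDiff ℝ ∞ f) : ContDiff ℝ ∞ (listDeriv l β f) := by
  induction l with
  | nil => exact hf
  | cons j l ih => exact contDiff_iterate_pdGS j _ ih

theorem listDeriv_congr (l : List (Fin d)) {β β' : Fin d → ℕ} (h : ∀ i ∈ l, β i = β' i)
    (f : Ed d → ℂ) : listDeriv l β f = listDeriv l β' f := by
  induction l with
  | nil => rfl
  | cons j l ih =>
    rw [listDeriv_cons, listDeriv_cons, h j (by simp), ih fun i hi => h i (by simp [hi])]

theorem pdGS_listDeriv (i : Fin d) {l : List (Fin d)} (hl : l.Nodup) (hi : i ∈ l)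
    (β : Fin d → ℕ) {f : Ed d → ℂ} (hf : ContDiff ℝ ∞ f) :
    pdGS i (listDeriv l β f) = listDeriv l (β + Pi.single i 1) f := by
  induction l with
  | nil => simp at hi
  | cons j l ih =>
    rw [List.nodup_cons] at hl
    rw [listDeriv_cons, listDeriv_cons]
    rcases eq_or_ne i j with rfl | hij
    · have : listDeriv l (β + Pi.single i 1) f = listDeriv l β f :=
        listDeriv_congr l (fun k hk => by
          have : k ≠ i := fun h => hl.1 (h ▸ hk)
          simp [this]) f
      rw [this, ← Function.iterate_succ_apply' (pdGS i)]
      simp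
    · rw [pdGS_iterate_comm i j _ (contDiff_listDeriv l β hf),
        ih hl.2 (by simpa [hij] using hi)]
      simp [hij.symm]

theorem pdGS_mderiv (i : Fin d) (β : Fin d → ℕ) {f : Ed d → ℂ} (hf : ContDiff ℝ ∞ f) :
    pdGS i (mderiv β f) = mderiv (β + Pi.single i 1) f := by
  rw [mderiv_eq_listDeriv, mderiv_eq_listDeriv,
    pdGS_listDeriv i (List.nodup_finRange d) (List.mem_finRange i) β hf]

theorem mderiv_zero (f : Ed d → ℂ) : mderiv 0 f = f := by
  rw [mderiv_eq_listDeriv]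
  induction List.finRange d with
  | nil => rfl
  | cons j l ih => rw [listDeriv_cons, ih]; rfl

theorem mderiv_single (i : Fin d) (n : ℕ) {f : Ed d → ℂ} (hf : ContDiff ℝ ∞ f) :
    mderiv (Pi.single i n) f = (pdGS i)^[n] f := by
  induction n with
  | zero => rw [Pi.single_zero, mderiv_zero]; rfl
  | succ n ih =>
    rw [Function.iterate_succ_apply', ← ih, pdGS_mderiv i _ hf, ← Pi.single_add]

theorem contDiff_mderiv (β : Fin d → ℕ) {f : Ed d → ℂ} (hf : ContDiff ℝ ∞ f) :
    ContDiff ℝ ∞ (mderiv β f) := by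
  rw [mderiv_eq_listDeriv]
  exact contDiff_listDeriv _ β hf

end SchwartzCriterion

section GelfandShilov

open SchwartzMap LineDeriv Topology FourierTransform
open scoped ContDiff

variable {d : ℕ} {s : ℝ}

theorem mpow_single (x : Ed d) (i : Fin d) (n : ℕ) : mpow x (Pi.single i n) = x i ^ n := by
  rw [mpow, Finset.prod_eq_single i] <;> simp +contextual

theorem mfact_single (i : Fin d) (n : ℕ) : mfact (Pi.single i n : Fin d → ℕ) = n.factorial := by
  rw [mfact, Finset.prod_eq_single i] <;> simp +contextual

theorem mlen_single (i : Fin d) (n : ℕ) : mlen (Pi.single i n : Fin d → ℕ) = n := by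
  rw [mlen, Finset.sum_eq_single i] <;> simp +contextual

theorem mfact_pos (α : Fin d → ℕ) : 0 < mfact α :=
  Finset.prod_pos fun _ _ => Nat.factorial_pos _

theorem SigmaGS.exists_bound {f : Ed d → ℂ} (hf : f ∈ SigmaGS s d) {h : ℝ} (hh : 0 < h) :
    ∃ C : ℝ, 0 ≤ C ∧ ∀ (x : Ed d) (α β : Fin d → ℕ), |mpow x α| * ‖mderiv β f x‖ ≤
      C * (h ^ (mlen α + mlen β) * ((mfact α : ℝ) * (mfact β : ℝ)) ^ s) := by
  have hlt := hf.2 h hh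
  refine ⟨(GSnorm s h f).toReal, ENNReal.toReal_nonneg, fun x α β => ?_⟩
  have hα : (0 : ℝ) < mfact α := mod_cast mfact_pos α
  have hβ : (0 : ℝ) < mfact β := mod_cast mfact_pos β
  have hpos : 0 < h ^ (mlen α + mlen β) * ((mfact α : ℝ) * (mfact β : ℝ)) ^ s := by positivity
  rw [← div_le_iff₀ hpos, ← ENNReal.ofReal_le_iff_le_toReal hlt.ne]
  exact le_iSup_of_le x (le_iSup_of_le α (le_iSup_of_le β le_rfl))

theorem exists_norm_le_card_mul_abs [Nonempty (Fin d)] (x : Ed d) :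
    ∃ i, ‖x‖ ≤ d * |x i| := by
  obtain ⟨i, hi⟩ := Finite.exists_max fun i => |x i|
  refine ⟨i, ?_⟩
  have h1 : ‖x‖ ≤ ∑ i, |x i| := by
    conv_lhs => rw [← (EuclideanSpace.basisFun (Fin d) ℝ).sum_repr x]
    refine (norm_sum_le _ _).trans (le_of_eq (Finset.sum_congr rfl fun i _ => ?_))
    rw [norm_smul]
    simp
  refine h1.trans ((Finset.sum_le_sum fun j _ => hi j).trans ?_)
  simp

theorem SigmaGS.exists_norm_pow_mul_mderiv_le {f : Ed d → ℂ} (hf : f ∈ SigmaGS s d) (k : ℕ)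
    {h : ℝ} (hh : 0 < h) : ∃ C : ℝ, 0 ≤ C ∧ ∀ (x : Ed d) (β : Fin d → ℕ),
      ‖x‖ ^ k * ‖mderiv β f x‖ ≤ C * (h ^ mlen β * (mfact β : ℝ) ^ s) := by
  obtain ⟨C, hC, hb⟩ := SigmaGS.exists_bound hf hh
  rcases isEmpty_or_nonempty (Fin d) with hd | hd
  · refine ⟨C, hC, fun x β => ?_⟩
    have hx : x = 0 := Subsingleton.elim _ _
    have h1 := hb x 0 β
    have h2 : ‖x‖ ^ k ≤ 1 := by rw [hx, norm_zero]; exact pow_le_one₀ le_rfl zero_le_one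
    simp only [mpow, mlen, mfact, Finset.univ_eq_empty, Finset.prod_empty, Finset.sum_empty,
      abs_one, one_mul, Nat.cast_one, zero_add] at h1 ⊢
    exact (mul_le_of_le_one_left (norm_nonneg _) h2).trans h1
  · refine ⟨d ^ k * (C * (h ^ k * (k.factorial : ℝ) ^ s)), by positivity, fun x β => ?_⟩
    obtain ⟨i, hi⟩ := exists_norm_le_card_mul_abs x
    have h1 := hb x (Pi.single i k) β
    rw [mpow_single, mlen_single, mfact_single, abs_pow, Real.mul_rpow (by positivity)
      (by positivity), pow_add] at h1
    calc ‖x‖ ^ k * ‖mderiv β f x‖ ≤ (d * |x i|) ^ k * ‖mderiv β f x‖ := by gcongr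
      _ = d ^ k * (|x i| ^ k * ‖mderiv β f x‖) := by ring
      _ ≤ d ^ k * (C * (h ^ k * h ^ mlen β * ((k.factorial : ℝ) ^ s * (mfact β : ℝ) ^ s))) := by
          gcongr
      _ = _ := by ring

theorem SigmaGS.exists_schwartzMap {f : Ed d → ℂ} (hf : f ∈ SigmaGS s d) :
    ∃ F : 𝓢(Ed d, ℂ), ∀ x, F x = f x := by
  refine exists_schwartzMap_eq (S := {g | ∃ β, g = mderiv β f}) ?_ ?_ ?_ ⟨0, (mderiv_zero f).symm⟩
  · rintro _ ⟨β, rfl⟩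
    exact contDiff_mderiv β hf.1
  · rintro _ ⟨β, rfl⟩ i
    exact ⟨β + Pi.single i 1, pdGS_mderiv i β hf.1⟩
  · rintro _ ⟨β, rfl⟩ k
    obtain ⟨C, -, h⟩ := SigmaGS.exists_norm_pow_mul_mderiv_le hf k one_pos
    exact ⟨_, fun x => h x β⟩

/-- Moment bounds of factorial type give exponential decay. -/
theorem norm_le_exp_of_forall_pow_le (hs : 0 < s) {h C a t : ℝ} (hh : 0 < h) (hC : 0 ≤ C)
    (ha : 0 ≤ a) (ht : 0 ≤ t)
    (hb : ∀ n : ℕ, t ^ n * a ≤ C * (h ^ n * (n.factorial : ℝ) ^ s)) :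
    a ≤ 2 ^ s * C * Real.exp (-(s / 2) * (t / h) ^ (1 / s)) := by
  set τ := (t / h) ^ (1 / s) with hτ
  have hτ0 : 0 ≤ τ := by positivity
  have hp : 0 < 1 / s := by positivity
  have h1 : ∀ n : ℕ, a ^ (1 / s) * τ ^ n ≤ C ^ (1 / s) * n.factorial := by
    intro n
    have h2 : (t / h) ^ n * a ≤ C * (n.factorial : ℝ) ^ s := by
      rw [div_pow, div_mul_eq_mul_div, div_le_iff₀ (by positivity)]
      linarith [hb n]
    have h3 := Real.rpow_le_rpow (by positivity) h2 hp.le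
    rw [Real.mul_rpow (by positivity) ha, Real.mul_rpow hC (by positivity),
      ← Real.rpow_mul (by positivity), mul_one_div_cancel hs.ne', Real.rpow_one] at h3
    have h4 : ((t / h) ^ n) ^ (1 / s) = τ ^ n := by
      rw [hτ, ← Real.rpow_natCast, ← Real.rpow_natCast, ← Real.rpow_mul (by positivity),
        ← Real.rpow_mul (by positivity), mul_comm]
    rw [h4] at h3
    linarith
  have h5 : a ^ (1 / s) * Real.exp (τ / 2) ≤ C ^ (1 / s) * 2 := by
    have hs1 : HasSum (fun n : ℕ => a ^ (1 / s) * ((τ / 2) ^ n / n.factorial))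
        (a ^ (1 / s) * Real.exp (τ / 2)) := by
      have := NormedSpace.expSeries_div_hasSum_exp (τ / 2)
      rw [← Real.exp_eq_exp_ℝ] at this
      exact this.mul_left _
    have hs2 : HasSum (fun n : ℕ => C ^ (1 / s) * (1 / 2) ^ n) (C ^ (1 / s) * 2) :=
      hasSum_geometric_two.mul_left _
    refine hasSum_le (fun n => ?_) hs1 hs2
    have hn : (0 : ℝ) < n.factorial := by positivity
    rw [div_pow, div_div, ← mul_div_assoc, div_le_iff₀ (by positivity)]
    calc a ^ (1 / s) * τ ^ n ≤ C ^ (1 / s) * n.factorial := h1 n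
      _ = _ := by rw [one_div, one_div, inv_pow]; field_simp
  have h6 := Real.rpow_le_rpow (by positivity) h5 hs.le
  rw [Real.mul_rpow (by positivity) (by positivity), Real.mul_rpow (by positivity) (by positivity),
    ← Real.rpow_mul ha, ← Real.rpow_mul hC, one_div_mul_cancel hs.ne', Real.rpow_one,
    Real.rpow_one, ← Real.exp_mul] at h6
  rw [neg_mul, Real.exp_neg, ← div_eq_mul_inv, le_div_iff₀ (Real.exp_pos _)]
  calc _ = a * Real.exp (τ / 2 * s) := by ring_nf
    _ ≤ _ := by linarith

theorem superDecayOn_of_forall_pow_le (hs : 0 < s) {g : Ed d → ℂ}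
    (hb : ∀ h : ℝ, 0 < h → ∃ C : ℝ, 0 ≤ C ∧ ∀ (x : Ed d) (i : Fin d) (n : ℕ),
      |x i| ^ n * ‖g x‖ ≤ C * (h ^ n * (n.factorial : ℝ) ^ s)) :
    SuperDecayOn (1 / s) Set.univ g := by
  intro A hA
  have hp : 0 < 1 / s := by positivity
  rcases isEmpty_or_nonempty (Fin d) with hd | hd
  · refine ⟨‖g 0‖, norm_nonneg _, fun x _ => ?_⟩
    have hx : x = 0 := Subsingleton.elim _ _
    rw [hx, norm_zero, Real.zero_rpow hp.ne', mul_zero, Real.exp_zero, mul_one]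
  · have hd0 : (0 : ℝ) < d := by
      have : 0 < d := Fin.pos_iff_nonempty.2 hd
      exact_mod_cast this
    set h := ((s / 2) / A) ^ s / d with hh
    have hh0 : 0 < h := by positivity
    obtain ⟨C, hC, hb⟩ := hb h hh0
    refine ⟨2 ^ s * C, by positivity, fun x _ => ?_⟩
    obtain ⟨i, hi⟩ := exists_norm_le_card_mul_abs x
    refine (norm_le_exp_of_forall_pow_le hs hh0 hC (norm_nonneg _) (abs_nonneg _)
      (hb x i)).trans ?_
    refine mul_le_mul_of_nonneg_left (Real.exp_le_exp.2 ?_) (by positivity)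
    have h1 : (‖x‖ / (d * h)) ^ (1 / s) ≤ (|x i| / h) ^ (1 / s) := by
      refine Real.rpow_le_rpow (by positivity) ?_ hp.le
      rw [div_le_div_iff₀ (by positivity) hh0]
      nlinarith
    have h2 : (‖x‖ / (d * h)) ^ (1 / s) = ‖x‖ ^ (1 / s) / ((s / 2) / A) := by
      rw [hh, mul_div_cancel₀ _ hd0.ne', Real.div_rpow (norm_nonneg _) (by positivity),
        ← Real.rpow_mul (by positivity), mul_one_div_cancel hs.ne', Real.rpow_one]
    rw [h2, div_div_eq_mul_div, div_le_iff₀ (by positivity)] at h1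
    linarith

theorem pow_abs_mul_norm_fourier_eq (F : 𝓢(Ed d, ℂ)) (i : Fin d) (n : ℕ) (ξ : Ed d) :
    ∃ G : 𝓢(Ed d, ℂ), (∀ x, G x = (pdGS i)^[n] F x) ∧
      (2 * Real.pi * |ξ i|) ^ n * ‖𝓕 F ξ‖ = ‖𝓕 G ξ‖ := by
  induction n with
  | zero => exact ⟨F, fun _ => rfl, by simp⟩
  | succ n ih =>
    obtain ⟨G, hG, he⟩ := ih
    refine ⟨∂_{(EuclideanSpace.single i (1 : ℝ) : Ed d)} G, fun x => ?_, ?_⟩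
    · rw [Function.iterate_succ_apply', ← funext hG]
      exact SchwartzMap.lineDerivOp_apply_eq_fderiv _ _ _
    · have ht : Function.HasTemperateGrowth
          (inner ℝ · (EuclideanSpace.single i (1 : ℝ)) : Ed d → ℝ) :=
        ((innerSL ℝ).flip (EuclideanSpace.single i (1 : ℝ))).hasTemperateGrowth
      rw [SchwartzMap.fourier_lineDerivOp_eq, smul_apply, smulLeftCLM_apply_apply ht, norm_smul,
        norm_smul, ← he, pow_succ]
      simp [abs_of_pos Real.pi_pos, EuclideanSpace.inner_single_right]
      ring

theorem SigmaGS.isDecayWindow (hs : 0 < s) {f : Ed d → ℂ} (hf : f ∈ SigmaGS s d)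
    {F : 𝓢(Ed d, ℂ)} (hF : ∀ x, F x = f x) : IsDecayWindow (1 / s) F := by
  have hFf : (F : Ed d → ℂ) = f := funext hF
  refine ⟨superDecayOn_of_forall_pow_le hs fun h hh => ?_,
    superDecayOn_of_forall_pow_le hs fun h hh => ?_⟩
  · obtain ⟨C, hC, hb⟩ := SigmaGS.exists_bound hf hh
    refine ⟨C, hC, fun x i n => ?_⟩
    have := hb x (Pi.single i n) 0
    rw [mderiv_zero, mpow_single, mlen_single, mfact_single, abs_pow] at this
    simpa [mlen, mfact, hF] using this
  · obtain ⟨C₀, hC₀, hb₀⟩ := SigmaGS.exists_norm_pow_mul_mderiv_le hf 0 hh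
    obtain ⟨C₁, hC₁, hb₁⟩ := SigmaGS.exists_norm_pow_mul_mderiv_le hf
      (Module.finrank ℝ (Ed d) + 1) hh
    set m := Module.finrank ℝ (Ed d) + 1 with hm
    set w : Ed d → ℝ := fun x => ((1 + ‖x‖) ^ m)⁻¹ with hw
    have hwi : Integrable w := integrable_one_add_norm_pow_inv volume
    refine ⟨2 ^ m * (C₀ + C₁) * ∫ x, w x, mul_nonneg (by positivity)
      (integral_nonneg fun x => by positivity), fun ξ i n => ?_⟩
    obtain ⟨G, hG, he⟩ := pow_abs_mul_norm_fourier_eq F i n ξ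
    have h1 : |ξ i| ^ n * ‖𝓕 F ξ‖ ≤ ‖𝓕 G ξ‖ := by
      rw [← he]
      gcongr
      have := Real.pi_gt_three
      nlinarith [abs_nonneg (ξ i)]
    have h2 : ‖𝓕 G ξ‖ ≤ ∫ x, ‖G x‖ := by
      rw [fourier_coe]
      exact VectorFourier.norm_fourierIntegral_le_integral_norm _ _ _ _ _
    refine (h1.trans h2).trans ?_
    rw [mul_right_comm, ← integral_const_mul]
    refine integral_mono_of_nonneg (Eventually.of_forall fun x => norm_nonneg _)
      (hwi.const_mul _) (Eventually.of_forall fun x => ?_)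
    have h3 := hb₀ x (Pi.single i n)
    have h4 := hb₁ x (Pi.single i n)
    rw [mlen_single, mfact_single, mderiv_single i n hf.1, ← hFf, ← hG] at h3 h4
    have h5 : (1 + ‖x‖) ^ m ≤ 2 ^ m * (‖x‖ ^ 0 + ‖x‖ ^ m) := by
      have h6 : (1 + ‖x‖) ^ m ≤ (2 * max 1 ‖x‖) ^ m := by
        gcongr
        linarith [le_max_left 1 ‖x‖, le_max_right 1 ‖x‖]
      refine h6.trans ?_
      rw [mul_pow, pow_zero]
      gcongr
      rcases le_total 1 ‖x‖ with h | h
      · rw [max_eq_right h]; linarith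
      · rw [max_eq_left h, one_pow]; linarith [pow_nonneg (norm_nonneg x) m]
    simp only [hw]
    rw [← div_eq_mul_inv, le_div_iff₀ (by positivity), mul_comm]
    calc (1 + ‖x‖) ^ m * ‖G x‖ ≤ 2 ^ m * (‖x‖ ^ 0 + ‖x‖ ^ m) * ‖G x‖ := by gcongr
      _ = 2 ^ m * (‖x‖ ^ 0 * ‖G x‖ + ‖x‖ ^ m * ‖G x‖) := by ring
      _ ≤ 2 ^ m * (C₀ * (h ^ n * (n.factorial : ℝ) ^ s) +
            C₁ * (h ^ n * (n.factorial : ℝ) ^ s)) := by gcongr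
      _ = _ := by ring

end GelfandShilov

section QuadraticForm

variable {d : ℕ}

/-- The operator on `ℝ^d` given by the matrix `B`. -/
def matCLM (B : Matrix (Fin d) (Fin d) ℝ) : Ed d →L[ℝ] Ed d :=
  Matrix.toEuclideanCLM (n := Fin d) (𝕜 := ℝ) B

theorem matCLM_apply (B : Matrix (Fin d) (Fin d) ℝ) (x : Ed d) (i : Fin d) :
    matCLM B x i = ∑ j, B i j * x j := by
  simp [matCLM, Matrix.mulVec, dotProduct]

theorem qf_eq_inner (B : Matrix (Fin d) (Fin d) ℝ) (x : Ed d) : qf B x = ⟪matCLM B x, x⟫ := by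
  simp [qf, PiLp.inner_apply, matCLM_apply, mul_comm]

theorem inner_matCLM_comm {B : Matrix (Fin d) (Fin d) ℝ} (hB : B.IsSymm) (x y : Ed d) :
    ⟪matCLM B x, y⟫ = ⟪x, matCLM B y⟫ := by
  simp only [PiLp.inner_apply, matCLM_apply, RCLike.inner_apply, conj_trivial, Finset.mul_sum,
    Finset.sum_mul]
  rw [Finset.sum_comm]
  refine Finset.sum_congr rfl fun i _ => Finset.sum_congr rfl fun j _ => ?_
  rw [hB.apply i j]
  ring

theorem qf_eq_add_sub {B : Matrix (Fin d) (Fin d) ℝ} (hB : B.IsSymm) (x y : Ed d) :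
    qf B y = qf B (y - x) + 2 * ⟪y, matCLM B x⟫ - qf B x := by
  simp only [qf_eq_inner, map_sub, inner_sub_left, inner_sub_right]
  rw [inner_matCLM_comm hB y x, real_inner_comm y (matCLM B x)]
  ring

theorem exists_orthonormalBasis_qf_eq {B : Matrix (Fin d) (Fin d) ℝ} (hB : B.IsSymm) :
    ∃ (b : OrthonormalBasis (Fin d) ℝ (Ed d)) (μ : Fin d → ℝ),
      ∀ x, qf B x = ∑ i, μ i * b.repr x i ^ 2 := by
  have hH : B.IsHermitian := by
    rw [Matrix.IsHermitian, Matrix.conjTranspose_eq_transpose_of_trivial]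
    exact hB
  refine ⟨hH.eigenvectorBasis, hH.eigenvalues, fun x => ?_⟩
  have h1 : ∀ i, matCLM B (hH.eigenvectorBasis i) =
      hH.eigenvalues i • hH.eigenvectorBasis i := by
    intro i
    ext j
    have := congrFun (hH.mulVec_eigenvectorBasis i) j
    simpa [matCLM] using this
  rw [qf_eq_inner, ← hH.eigenvectorBasis.sum_inner_mul_inner]
  refine Finset.sum_congr rfl fun i _ => ?_
  rw [inner_matCLM_comm hB, h1, inner_smul_right, OrthonormalBasis.repr_apply_apply,
    real_inner_comm]
  ring

end QuadraticForm

section GaussianChirp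

open SchwartzMap LineDeriv Topology FourierTransform Function
open scoped ContDiff

variable {d : ℕ}

theorem hasTemperateGrowth_pdGS (i : Fin d) {P : Ed d → ℂ} (hP : P.HasTemperateGrowth) :
    (pdGS i P).HasTemperateGrowth := by
  have h : (fderiv ℝ P).HasTemperateGrowth :=
    ⟨hP.1.fderiv_right (m := ∞) (by simp), fun n => by
      obtain ⟨k, C, h⟩ := hP.2 (n + 1)
      exact ⟨k, C, fun x => by rw [norm_iteratedFDeriv_fderiv]; exact h x⟩⟩
  exact (ContinuousLinearMap.apply ℝ ℂ
    (EuclideanSpace.single i (1 : ℝ))).hasTemperateGrowth.comp h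

/-- The exponent `-‖y‖² / 2 + i ⟨By, y⟩ / 2`. -/
def chirpExponent (B : Matrix (Fin d) (Fin d) ℝ) (y : Ed d) : ℂ :=
  -((‖y‖ ^ 2 : ℝ) : ℂ) / 2 + Complex.I * ((qf B y : ℝ) : ℂ) / 2

theorem hasTemperateGrowth_chirpExponent (B : Matrix (Fin d) (Fin d) ℝ) :
    (chirpExponent B).HasTemperateGrowth := by
  have h1 : Function.HasTemperateGrowth fun y : Ed d => ((‖y‖ ^ 2 : ℝ) : ℂ) :=
    Complex.hasTemperateGrowth_ofReal.comp (hasTemperateGrowth_norm_sq (Ed d))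
  have h2 : Function.HasTemperateGrowth fun y : Ed d => ((qf B y : ℝ) : ℂ) := by
    refine Complex.hasTemperateGrowth_ofReal.comp ?_
    have : qf B = fun y => innerSL ℝ (matCLM B y) y := by
      ext y; rw [qf_eq_inner]; rfl
    rw [this]
    exact (innerSL ℝ).bilinear_hasTemperateGrowth (matCLM B).hasTemperateGrowth
      HasTemperateGrowth.id'
  have h3 : chirpExponent B = fun y => (-1 / 2 : ℂ) * ((‖y‖ ^ 2 : ℝ) : ℂ) +
      (Complex.I / 2) * ((qf B y : ℝ) : ℂ) := by
    ext y; rw [chirpExponent]; ring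
  rw [h3]
  exact ((HasTemperateGrowth.const _).mul h1).add ((HasTemperateGrowth.const _).mul h2)

theorem norm_exp_chirpExponent (B : Matrix (Fin d) (Fin d) ℝ) (y : Ed d) :
    ‖Complex.exp (chirpExponent B y)‖ = Real.exp (-(1 / 2) * ‖y‖ ^ 2) := by
  rw [Complex.norm_exp]
  congr 1
  have : chirpExponent B y = ((-(1 / 2) * ‖y‖ ^ 2 : ℝ) : ℂ) +
      ((qf B y / 2 : ℝ) : ℂ) * Complex.I := by
    rw [chirpExponent]; push_cast; ring
  rw [this, Complex.add_re, Complex.ofReal_re, Complex.re_ofReal_mul, Complex.I_re, mul_zero,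
    add_zero]

theorem exists_schwartzMap_eq_exp_chirpExponent (B : Matrix (Fin d) (Fin d) ℝ) :
    ∃ F : 𝓢(Ed d, ℂ), ∀ y, F y = Complex.exp (chirpExponent B y) := by
  have hθ := hasTemperateGrowth_chirpExponent B
  refine exists_schwartzMap_eq
    (S := {f | ∃ P : Ed d → ℂ, P.HasTemperateGrowth ∧
      f = fun y => P y * Complex.exp (chirpExponent B y)}) ?_ ?_ ?_
    ⟨fun _ => 1, HasTemperateGrowth.const 1, by simp⟩
  · rintro _ ⟨P, hP, rfl⟩
    exact hP.1.mul hθ.1.cexp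
  · rintro _ ⟨P, hP, rfl⟩ i
    refine ⟨_, (hasTemperateGrowth_pdGS i hP).add (hP.mul (hasTemperateGrowth_pdGS i hθ)), ?_⟩
    ext x
    have h1 : HasFDerivAt P (fderiv ℝ P x) x := (hP.1.differentiable (by simp) x).hasFDerivAt
    have h2 : HasFDerivAt (chirpExponent B) (fderiv ℝ (chirpExponent B) x) x :=
      (hθ.1.differentiable (by simp) x).hasFDerivAt
    have h3 : fderiv ℝ (fun y => P y * Complex.exp (chirpExponent B y)) x = _ :=
      (h1.mul h2.cexp).fderiv
    rw [pdGS, h3]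
    simp [pdGS]
    ring
  · rintro _ ⟨P, hP, rfl⟩ k
    obtain ⟨m, C, h⟩ := hP.2 0
    obtain ⟨K, hK, hb⟩ := exists_one_add_pow_mul_exp_neg_rpow_le two_pos one_half_pos (k + m)
    have hC : 0 ≤ C := by simpa using (norm_nonneg _).trans (h 0)
    refine ⟨C * K, fun x => ?_⟩
    have h1 := h x
    rw [norm_iteratedFDeriv_zero] at h1
    have h2 := hb ‖x‖ (norm_nonneg x)
    rw [Real.rpow_two] at h2
    rw [norm_mul, norm_exp_chirpExponent]
    calc ‖x‖ ^ k * (‖P x‖ * Real.exp (-(1 / 2) * ‖x‖ ^ 2))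
        ≤ (1 + ‖x‖) ^ k * ((C * (1 + ‖x‖) ^ m) * Real.exp (-(1 / 2) * ‖x‖ ^ 2)) := by
          refine mul_le_mul (pow_le_pow_left₀ (norm_nonneg _) (by linarith) _)
            (mul_le_mul_of_nonneg_right h1 (Real.exp_pos _).le) (by positivity) (by positivity)
      _ = C * ((1 + ‖x‖) ^ (k + m) * Real.exp (-(1 / 2) * ‖x‖ ^ 2)) := by ring
      _ ≤ C * K := mul_le_mul_of_nonneg_left h2 hC

theorem superDecayOn_of_norm_le_exp_neg_sq {p C c : ℝ} (hp : 0 < p) (hp2 : p < 2) (hC : 0 ≤ C)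
    (hc : 0 < c) {f : Ed d → ℂ} (hf : ∀ x, ‖f x‖ ≤ C * Real.exp (-c * ‖x‖ ^ 2)) :
    SuperDecayOn p Set.univ f := by
  intro A hA
  set R := (A / c) ^ (1 / (2 - p)) with hR
  have hR0 : 0 < R := by positivity
  refine ⟨C * Real.exp (A * R ^ p), by positivity, fun x _ => (hf x).trans ?_⟩
  rw [mul_assoc, ← Real.exp_add]
  refine mul_le_mul_of_nonneg_left (Real.exp_le_exp.2 ?_) hC
  rcases le_total ‖x‖ R with h | h
  · have h1 := Real.rpow_le_rpow (norm_nonneg x) h hp.le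
    nlinarith [mul_nonneg hc.le (sq_nonneg ‖x‖), mul_le_mul_of_nonneg_left h1 hA.le]
  · have hx : 0 < ‖x‖ := hR0.trans_le h
    have h1 : A / c ≤ ‖x‖ ^ (2 - p) := by
      have := Real.rpow_le_rpow hR0.le h (sub_nonneg.2 hp2.le)
      rwa [hR, ← Real.rpow_mul (by positivity), one_div_mul_cancel (sub_pos.2 hp2).ne',
        Real.rpow_one] at this
    rw [div_le_iff₀ hc] at h1
    have h2 : ‖x‖ ^ 2 = ‖x‖ ^ (2 - p) * ‖x‖ ^ p := by
      rw [← Real.rpow_add hx, sub_add_cancel, Real.rpow_two]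
    have h3 : 0 ≤ A * R ^ p := by positivity
    have h4 := mul_le_mul_of_nonneg_right h1 (Real.rpow_nonneg hx.le p)
    rw [h2]
    linarith

theorem exists_norm_integral_exp_quadratic_le (μ : Fin d → ℝ) :
    ∃ C c : ℝ, 0 ≤ C ∧ 0 < c ∧ ∀ η : Fin d → ℝ,
      ‖∫ v : Fin d → ℝ, Complex.exp (-∑ i, ((1 - μ i * Complex.I) / 2) * (v i : ℂ) ^ 2 +
        ∑ i, (-(2 * Real.pi * η i : ℝ) * Complex.I) * v i)‖ ≤
      C * Real.exp (-c * ∑ i, η i ^ 2) := by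
  set b : Fin d → ℂ := fun i => (1 - μ i * Complex.I) / 2 with hb
  have hre : ∀ i, (b i).re = 1 / 2 := fun i => by simp [hb]
  have hns : ∀ i, 0 < Complex.normSq (b i) := fun i => by
    rw [Complex.normSq_pos]
    intro h
    have := hre i
    rw [h] at this
    norm_num at this
  set M := 1 + ∑ i, Complex.normSq (b i) with hM
  have hM0 : 0 < M := by
    have := Finset.sum_nonneg fun i (_ : i ∈ Finset.univ) => (hns i).le
    linarith
  refine ⟨∏ i, ‖((Real.pi : ℂ) / b i) ^ (1 / 2 : ℂ)‖, Real.pi ^ 2 / (2 * M),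
    Finset.prod_nonneg fun _ _ => norm_nonneg _, by positivity, fun η => ?_⟩
  rw [GaussianFourier.integral_cexp_neg_sum_mul_add (fun i => by rw [hre]; norm_num),
    Finset.prod_mul_distrib, norm_mul, norm_prod, norm_prod, Finset.mul_sum, Real.exp_sum]
  refine mul_le_mul_of_nonneg_left (Finset.prod_le_prod (fun _ _ => norm_nonneg _) fun i _ => ?_)
    (Finset.prod_nonneg fun _ _ => norm_nonneg _)
  rw [Complex.norm_exp]
  refine Real.exp_le_exp.2 ?_
  have h1 : (-(2 * Real.pi * η i : ℝ) * Complex.I) ^ 2 / (4 * b i) =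
      ((-(Real.pi ^ 2 * η i ^ 2) : ℝ) : ℂ) * (b i)⁻¹ := by
    rw [mul_pow, Complex.I_sq]
    push_cast
    field_simp
    ring
  rw [h1, Complex.re_ofReal_mul, Complex.inv_re, hre]
  have h2 : Complex.normSq (b i) ≤ M := by
    have := Finset.single_le_sum (f := fun i => Complex.normSq (b i))
      (fun i _ => (hns i).le) (Finset.mem_univ i)
    linarith
  have h3 : 1 / 2 / M ≤ 1 / 2 / Complex.normSq (b i) :=
    div_le_div_of_nonneg_left (by norm_num) (hns i) h2
  have h4 := mul_le_mul_of_nonneg_left h3 (by positivity : 0 ≤ Real.pi ^ 2 * η i ^ 2)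
  calc _ ≤ -(Real.pi ^ 2 * η i ^ 2 * (1 / 2 / M)) := by linarith
    _ = _ := by field_simp

theorem exists_norm_fourier_exp_chirpExponent_le {B : Matrix (Fin d) (Fin d) ℝ} (hB : B.IsSymm) :
    ∃ C c : ℝ, 0 ≤ C ∧ 0 < c ∧ ∀ ξ : Ed d,
      ‖𝓕 (fun y => Complex.exp (chirpExponent B y)) ξ‖ ≤ C * Real.exp (-c * ‖ξ‖ ^ 2) := by
  obtain ⟨b, μ, hq⟩ := exists_orthonormalBasis_qf_eq hB
  obtain ⟨C, c, hC, hc, h⟩ := exists_norm_integral_exp_quadratic_le μ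
  refine ⟨C, c, hC, hc, fun ξ => ?_⟩
  have h1 : ‖ξ‖ ^ 2 = ∑ i, b.repr ξ i ^ 2 := by
    rw [← b.repr.norm_map ξ, EuclideanSpace.real_norm_sq_eq]
  rw [h1]
  refine le_of_eq_of_le (congrArg norm ?_) (h (b.repr ξ))
  rw [Real.fourier_eq', ← b.measurePreserving_repr_symm.integral_comp
      b.repr.symm.toHomeomorph.measurableEmbedding,
    ← (PiLp.volume_preserving_toLp (Fin d)).integral_comp
      (MeasurableEquiv.toLp 2 _).measurableEmbedding]
  refine integral_congr_ae (Eventually.of_forall fun v => ?_)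
  have h2 : ⟪b.repr.symm (WithLp.toLp 2 v), ξ⟫ = ∑ i, v i * b.repr ξ i := by
    rw [b.repr.symm.inner_map_eq_flip]
    simp [PiLp.inner_apply, mul_comm]
  have h3 : ‖b.repr.symm (WithLp.toLp 2 v)‖ ^ 2 = ∑ i, v i ^ 2 := by
    rw [b.repr.symm.norm_map, EuclideanSpace.real_norm_sq_eq]
  simp only [smul_eq_mul, chirpExponent, h2, h3, hq, LinearIsometryEquiv.apply_symm_apply]
  rw [← Complex.exp_add]
  congr 1
  push_cast
  simp only [Finset.mul_sum, Finset.sum_mul, Finset.sum_div, ← Finset.sum_neg_distrib,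
    ← Finset.sum_add_distrib]
  refine Finset.sum_congr rfl fun i _ => ?_
  ring

theorem isDecayWindow_of_eq_exp_chirpExponent {B : Matrix (Fin d) (Fin d) ℝ} (hB : B.IsSymm)
    {p : ℝ} (hp : 0 < p) (hp2 : p < 2) {F : 𝓢(Ed d, ℂ)}
    (hF : ∀ y, F y = Complex.exp (chirpExponent B y)) : IsDecayWindow p F := by
  obtain ⟨C, c, hC, hc, h⟩ := exists_norm_fourier_exp_chirpExponent_le hB
  refine ⟨superDecayOn_of_norm_le_exp_neg_sq hp hp2 zero_le_one one_half_pos fun x => ?_,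
    superDecayOn_of_norm_le_exp_neg_sq hp hp2 hC hc fun x => ?_⟩
  · rw [hF, norm_exp_chirpExponent, one_mul]
  · rw [fourier_coe, show (F : Ed d → ℂ) = _ from funext hF]
    exact h x

end GaussianChirp

section ChirpMultiplication

open SchwartzMap

variable {d : ℕ} {s : ℝ}

/-- The rescaling `(x, ξ) ↦ (x, ξ / 2π)` of phase space. -/
def freqScale (d : ℕ) : (Ed d × Ed d) ≃L[ℝ] (Ed d × Ed d) :=
  (ContinuousLinearEquiv.refl ℝ (Ed d)).prodCongr
    (ContinuousLinearEquiv.smulLeft (Units.mk0 (2 * Real.pi)⁻¹ (by positivity)))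

theorem freqScale_apply (z : Ed d × Ed d) :
    freqScale d z = (z.1, (2 * Real.pi)⁻¹ • z.2) := rfl

/-- The shear `(x, ξ) ↦ (x, ξ - Bx / 2π)` of phase space. -/
def freqShear (B : Matrix (Fin d) (Fin d) ℝ) : (Ed d × Ed d) ≃L[ℝ] (Ed d × Ed d) :=
  ContinuousLinearEquiv.equivOfInverse
    ((ContinuousLinearMap.fst ℝ _ _).prod (ContinuousLinearMap.snd ℝ _ _ -
      (2 * Real.pi)⁻¹ • (matCLM B).comp (ContinuousLinearMap.fst ℝ _ _)))
    ((ContinuousLinearMap.fst ℝ _ _).prod (ContinuousLinearMap.snd ℝ _ _ +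
      (2 * Real.pi)⁻¹ • (matCLM B).comp (ContinuousLinearMap.fst ℝ _ _)))
    (fun z => by simp) (fun z => by simp)

theorem freqShear_apply (B : Matrix (Fin d) (Fin d) ℝ) (z : Ed d × Ed d) :
    freqShear B z = (z.1, z.2 - (2 * Real.pi)⁻¹ • matCLM B z.1) := rfl

theorem mem_WFs_iff_of_isSTFT (hs : 0 < s) {u : TD d} {φ : Ed d → ℂ} (hφ : φ ∈ SigmaGS s d)
    (hφ0 : φ ≠ 0) {W : Ed d × Ed d → ℂ} (hW : IsSTFT u φ W) {F : 𝓢(Ed d, ℂ)}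
    (hF : IsDecayWindow (1 / s) F) (hF0 : F ≠ 0) (z : Ed d × Ed d) :
    z ∈ WFs s W ↔ freqScale d z ∈ WFs s (fun z => u (tfShift z F)) := by
  obtain ⟨G, hG⟩ := SigmaGS.exists_schwartzMap hφ
  have hG0 : conjSchwartz G ≠ 0 := by
    intro h
    refine hφ0 (funext fun x => ?_)
    have := congrArg (fun K : 𝓢(Ed d, ℂ) => K x) h
    simpa [conjSchwartz_apply, hG] using this
  rw [WFs_tfShift_eq hs u hF (SigmaGS.isDecayWindow hs hφ hG).conj hF0 hG0]
  refine mem_WFs_iff_of_norm_comp_eq hs (freqScale d) (fun z => ?_) z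
  rw [hW z.1 z.2 (tfShift (freqScale d z) (conjSchwartz G)) fun y => ?_]
  rw [tfShift_apply, conjSchwartz_apply, hG, freqScale_apply, inner_smul_right,
    mul_inv_cancel_left₀ (by positivity), mul_comm, neg_mul, mul_comm Complex.I]

theorem norm_apply_tfShift_chirp {B : Matrix (Fin d) (Fin d) ℝ} (hB : B.IsSymm) {u v : TD d}
    (hv : ∀ ψ ψ' : 𝓢(Ed d, ℂ),
      (∀ x : Ed d, ψ' x = Complex.exp (Complex.I * ((qf B x : ℝ) : ℂ) / 2) * ψ x) → v ψ = u ψ')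
    {F G : 𝓢(Ed d, ℂ)}
    (hFG : ∀ y, G y = Complex.exp (Complex.I * ((qf B y : ℝ) : ℂ) / 2) * F y)
    (z : Ed d × Ed d) : ‖v (tfShift z F)‖ = ‖u (tfShift (freqShear B z) G)‖ := by
  rw [hv (tfShift z F)
    (Complex.exp (((-(qf B z.1 / 2) : ℝ) : ℂ) * Complex.I) • tfShift (freqShear B z) G)
    fun y => ?_, map_smul, norm_smul, Complex.norm_exp_ofReal_mul_I, one_mul]
  rw [smul_apply, smul_eq_mul, tfShift_apply, tfShift_apply, freqShear_apply, hFG,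
    qf_eq_add_sub hB z.1 y, inner_sub_right, inner_smul_right, ← mul_assoc, ← mul_assoc,
    ← mul_assoc, ← Complex.exp_add, ← Complex.exp_add, ← Complex.exp_add]
  congr 2
  have hpi : (Real.pi : ℂ) ≠ 0 := mod_cast Real.pi_ne_zero
  push_cast
  field_simp
  ring

theorem mem_WFs_chirp_iff (hs : 1 / 2 < s) {B : Matrix (Fin d) (Fin d) ℝ} (hB : B.IsSymm)
    {u v : TD d}
    (hv : ∀ ψ ψ' : 𝓢(Ed d, ℂ),
      (∀ x : Ed d, ψ' x = Complex.exp (Complex.I * ((qf B x : ℝ) : ℂ) / 2) * ψ x) → v ψ = u ψ')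
    {φ w : Ed d → ℂ} (hφ : φ ∈ SigmaGS s d) (hφ0 : φ ≠ 0) (hw : w ∈ SigmaGS s d) (hw0 : w ≠ 0)
    {Wu Wv : Ed d × Ed d → ℂ} (hWu : IsSTFT u φ Wu) (hWv : IsSTFT v w Wv) (z : Ed d × Ed d) :
    z ∈ WFs s Wv ↔ (z.1, z.2 - matCLM B z.1) ∈ WFs s Wu := by
  have hs0 : 0 < s := by linarith
  have hp2 : 1 / s < 2 := by rw [div_lt_iff₀ hs0]; linarith
  have h0 : (0 : Matrix (Fin d) (Fin d) ℝ).IsSymm := Matrix.transpose_zero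
  obtain ⟨F, hF⟩ := exists_schwartzMap_eq_exp_chirpExponent (0 : Matrix (Fin d) (Fin d) ℝ)
  obtain ⟨G, hG⟩ := exists_schwartzMap_eq_exp_chirpExponent B
  have hne : ∀ {B : Matrix (Fin d) (Fin d) ℝ} {F : 𝓢(Ed d, ℂ)},
      (∀ y, F y = Complex.exp (chirpExponent B y)) → F ≠ 0 := by
    rintro B F hF rfl
    exact Complex.exp_ne_zero _ (hF 0).symm
  have hFG : ∀ y, G y = Complex.exp (Complex.I * ((qf B y : ℝ) : ℂ) / 2) * F y := by
    intro y
    rw [hF, hG, ← Complex.exp_add, chirpExponent, chirpExponent]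
    congr 1
    simp [qf, add_comm]
  rw [mem_WFs_iff_of_isSTFT hs0 hw hw0 hWv
      (isDecayWindow_of_eq_exp_chirpExponent h0 (by positivity) hp2 hF) (hne hF),
    mem_WFs_iff_of_norm_comp_eq (W := fun z => u (tfShift z G)) hs0 (freqShear B)
      (norm_apply_tfShift_chirp hB hv hFG),
    mem_WFs_iff_of_isSTFT hs0 hφ hφ0 hWu
      (isDecayWindow_of_eq_exp_chirpExponent hB (by positivity) hp2 hG) (hne hG)]
  simp only [freqScale_apply, freqShear_apply, smul_sub]

end ChirpMultiplication

theorem statement10 (d : ℕ) (s : ℝ) (hs : 1/2 < s)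
    (B : Matrix (Fin d) (Fin d) ℝ) (hB : B.IsSymm)
    (u v : TD d)
    (hv : ∀ ψ ψ' : SchwartzMap (Ed d) ℂ,
      (∀ x : Ed d, ψ' x = Complex.exp (Complex.I * ((qf B x : ℝ) : ℂ) / 2) * ψ x) →
      v ψ = u ψ')
    (φ w : Ed d → ℂ) (hφ : φ ∈ SigmaGS s d) (hφ0 : φ ≠ 0)
    (hw : w ∈ SigmaGS s d) (hw0 : w ≠ 0)
    (Wu Wv : Ed d × Ed d → ℂ) (hWu : IsSTFT u φ Wu) (hWv : IsSTFT v w Wv) :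
    WFs s Wv = {p : Ed d × Ed d | ∃ z ∈ WFs s Wu,
      p.1 = z.1 ∧ ∀ i : Fin d, p.2 i = (∑ j, B i j * z.1 j) + z.2 i} := by
  ext p
  rw [mem_WFs_chirp_iff hs hB hv hφ hφ0 hw hw0 hWu hWv, Set.mem_ofPred_eq]
  constructor
  · intro h
    refine ⟨_, h, rfl, fun i => ?_⟩
    simp [matCLM_apply]
  · rintro ⟨z, hz, h1, h2⟩
    convert hz using 1
    refine Prod.ext h1 ?_
    ext i
    simp [h1, h2, matCLM_apply]

end
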